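/- Let $1 \leq m \leq n$ and $A, B_1,\dots,B_m$ be convex bodies in $\mathbb{R}^n$. Then $|A|^{m-1}\, V(B_1,\dots,B_m,A[n-m]) \leq 2^{m(m-1)/2} \prod_{i=1}^m V(B_i, A[n-1])$. -/

import Mathlib

open scoped Pointwise
open MeasureTheory

/-- A convex body in `ℝⁿ`: a compact convex set with nonempty interior. -/
def IsConvexBody {n : ℕ} (K : Set (EuclideanSpace ℝ (Fin n))) : Prop :=
  Convex ℝ K ∧ IsCompact K ∧ (interior K).Nonempty

/-- The mixed volume of `n` convex bodies in `ℝⁿ`, via the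
inclusion-exclusion (polarization) formula for Minkowski sums. -/
noncomputable def mixedVolume {n : ℕ} (K : Fin n → Set (EuclideanSpace ℝ (Fin n))) : ℝ :=
  ((n.factorial : ℝ))⁻¹ *
    ∑ S : Finset (Fin n), (-1 : ℝ) ^ (n + S.card) * (volume (∑ i ∈ S, K i)).toReal


namespace IterFen

/-- Binomially weighted polynomial. -/
noncomputable def bs (N : ℕ) (v : ℕ → ℝ) (t : ℝ) : ℝ :=
  ∑ j ∈ Finset.range (N + 1), (N.choose j : ℝ) * v j * t ^ j

/-- Shift of a sequence. -/
def sh (v : ℕ → ℝ) : ℕ → ℝ := fun j => v (j + 1)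

lemma bs_zero (v : ℕ → ℝ) (t : ℝ) : bs 0 v t = v 0 := by simp [bs]

lemma bs_succ (N : ℕ) (v : ℕ → ℝ) (t : ℝ) :
    bs (N + 1) v t = bs N v t + t * bs N (sh v) t := by
  unfold bs sh
  rw [Finset.sum_range_succ']
  simp only [Nat.choose_succ_succ, Nat.cast_add, add_mul, Finset.sum_add_distrib]
  have h1 : ∑ x ∈ Finset.range (N + 1), (N.choose (x + 1) : ℝ) * v (x + 1) * t ^ (x + 1)
      + (((N + 1).choose 0 : ℕ) : ℝ) * v 0 * t ^ 0
      = ∑ j ∈ Finset.range (N + 1), (N.choose j : ℝ) * v j * t ^ j := by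
    have := Finset.sum_range_succ' (fun j => (N.choose j : ℝ) * v j * t ^ j) (N + 1)
    rw [Finset.sum_range_succ] at this
    simp at this ⊢
    linarith
  rw [Finset.mul_sum]
  have h2 : ∑ x ∈ Finset.range (N + 1), (N.choose x : ℝ) * v (x + 1) * t ^ (x + 1)
      = ∑ i ∈ Finset.range (N + 1), t * ((N.choose i : ℝ) * v (i + 1) * t ^ i) := by
    apply Finset.sum_congr rfl
    intros; ring
  linarith

lemma bs_at_zero (N : ℕ) (v : ℕ → ℝ) : bs N v 0 = v 0 := by
  induction N with
  | zero => simp [bs_zero]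
  | succ N ih => rw [bs_succ, ih]; simp

lemma bs_nonneg (N : ℕ) (v : ℕ → ℝ) (hv : ∀ j, 0 ≤ v j) {t : ℝ} (ht : 0 ≤ t) : 0 ≤ bs N v t :=
  Finset.sum_nonneg fun j _ => by have := hv j; positivity

lemma bs_ge_zero (N : ℕ) (v : ℕ → ℝ) (hv : ∀ j, 0 ≤ v j) {t : ℝ} (ht : 0 ≤ t) :
    v 0 ≤ bs N v t := by
  induction N generalizing v with
  | zero => simp [bs_zero]
  | succ N ih =>
    rw [bs_succ]
    have := bs_nonneg N (sh v) (fun j => hv _) ht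
    have := ih v hv
    nlinarith [mul_nonneg ht (bs_nonneg N (sh v) (fun j => hv _) ht)]

lemma bs_hasDerivAt (N : ℕ) (v : ℕ → ℝ) (t : ℝ) :
    HasDerivAt (bs (N + 1) v) ((N + 1 : ℝ) * bs N (sh v) t) t := by
  induction N generalizing v with
  | zero =>
    have : bs (0 + 1) v = fun t => v 0 + t * v 1 := by
      ext t; rw [bs_succ, bs_zero, bs_zero]; rfl
    rw [this, bs_zero]
    simpa [sh] using ((hasDerivAt_id t).mul_const (v 1)).const_add (v 0)
  | succ N ih =>
    have : bs (N + 1 + 1) v = fun t => bs (N + 1) v t + t * bs (N + 1) (sh v) t := by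
      ext t; rw [bs_succ]
    rw [this]
    have h := (ih v).add ((hasDerivAt_id t).mul (ih (sh v)))
    have e : (((N + 1 : ℕ) : ℝ) + 1) * bs (N + 1) (sh v) t = (N + 1 : ℝ) * bs N (sh v) t
        + (1 * bs (N + 1) (sh v) t + id t * ((N + 1 : ℝ) * bs N (sh (sh v)) t)) := by
      rw [bs_succ N (sh v), id]
      push_cast
      ring
    rw [e]
    exact h

lemma bs_continuous (N : ℕ) (v : ℕ → ℝ) : Continuous (bs N v) := by
  unfold bs; fun_prop

lemma h_deriv (N : ℕ) (v : ℕ → ℝ) (hv : ∀ j, 0 ≤ v j) (v0 : v 0 = 1) {t : ℝ} (ht : 0 ≤ t) :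
    HasDerivAt (fun t => (bs (N + 2) v t) ^ (1 / ((N : ℝ) + 2)))
      ((bs (N + 2) v t) ^ (1 / ((N : ℝ) + 2) - 1) * bs (N + 1) (sh v) t) t := by
  have hp : 1 ≤ bs (N + 2) v t := v0 ▸ bs_ge_zero (N + 2) v hv ht
  have := (bs_hasDerivAt (N + 1) v t).rpow_const (p := 1 / ((N : ℝ) + 2)) (Or.inl (by positivity))
  convert this using 1
  push_cast
  field_simp
  ring

lemma h_anti (N : ℕ) (v : ℕ → ℝ) (hv : ∀ j, 0 ≤ v j) (v0 : v 0 = 1) 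
    (hc : ConcaveOn ℝ (Set.Ici 0) (fun t => (bs (N + 2) v t) ^ (1 / ((N : ℝ) + 2)))) : AntitoneOn (fun t => (bs (N + 2) v t) ^ (1 / ((N : ℝ) + 2) - 1)
    * bs (N + 1) (sh v) t) (Set.Ici 0) := by
  have := hc.antitoneOn_deriv (fun x hx => (h_deriv N v hv v0 hx).differentiableAt)
  refine this.congr ?_
  intro x hx
  exact (h_deriv N v hv v0 hx).deriv

lemma key_pos (N : ℕ) (v : ℕ → ℝ) (hv : ∀ j, 0 ≤ v j) (v0 : v 0 = 1) 
    (hc : ConcaveOn ℝ (Set.Ici 0) (fun t => (bs (N + 2) v t) ^ (1 / ((N : ℝ) + 2)))) {t : ℝ} (ht : 0 < t) :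
    bs (N + 2) v t * bs N (sh (sh v)) t ≤ (bs (N + 1) (sh v) t) ^ 2 := by
  have hp : 1 ≤ bs (N + 2) v t := v0 ▸ bs_ge_zero (N + 2) v hv ht.le
  have hp0 : 0 < bs (N + 2) v t := by linarith
  have h1 := ((bs_hasDerivAt (N + 1) v t).rpow_const (p := 1 / ((N : ℝ) + 2) - 1)
    (Or.inl (by positivity))).mul (bs_hasDerivAt N (sh v) t)
  have h2 := (h_anti N v hv v0 hc).derivWithin_nonpos (x := t)
  have h3 := (h1.hasDerivWithinAt (s := Set.Ici 0)).derivWithin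
    ((uniqueDiffOn_Ici 0) t ht.le)
  change derivWithin (fun t => (bs (N + 2) v t) ^ (1 / ((N : ℝ) + 2) - 1)
    * bs (N + 1) (sh v) t) (Set.Ici 0) t = _ at h3
  rw [h3] at h2
  set P0 := bs (N + 2) v t
  set P1 := bs (N + 1) (sh v) t
  set P2 := bs N (sh (sh v)) t
  have e1 : P0 ^ (1 / ((N : ℝ) + 2) - 1) = P0 * P0 ^ (1 / ((N : ℝ) + 2) - 1 - 1) := by
    nth_rewrite 2 [← Real.rpow_one P0]
    rw [← Real.rpow_add hp0]; congr 1; ring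
  have e2 : 0 < P0 ^ (1 / ((N : ℝ) + 2) - 1 - 1) := Real.rpow_pos_of_pos hp0 _
  rw [e1] at h2
  set Q := P0 ^ (1 / ((N : ℝ) + 2) - 1 - 1)
  have h4 : (N + 1 : ℝ) * Q * (P0 * P2 - P1 ^ 2) ≤ 0 := by
    refine le_trans (le_of_eq ?_) h2
    push_cast
    field_simp
    ring
  have h5 : 0 < (N + 1 : ℝ) * Q := by positivity
  nlinarith [nonpos_of_mul_nonpos_right h4 h5]

lemma key (N : ℕ) (v : ℕ → ℝ) (hv : ∀ j, 0 ≤ v j) (v0 : v 0 = 1) 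
    (hc : ConcaveOn ℝ (Set.Ici 0) (fun t => (bs (N + 2) v t) ^ (1 / ((N : ℝ) + 2)))) {t : ℝ} (ht : 0 ≤ t) :
    bs (N + 2) v t * bs N (sh (sh v)) t ≤ (bs (N + 1) (sh v) t) ^ 2 := by
  have hcl : IsClosed {t : ℝ | bs (N + 2) v t * bs N (sh (sh v)) t ≤ (bs (N + 1) (sh v) t) ^ 2} :=
    isClosed_le ((bs_continuous _ _).mul (bs_continuous _ _)) ((bs_continuous _ _).pow 2)
  have : closure (Set.Ioi (0:ℝ)) ⊆ _ := hcl.closure_subset_iff.2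
    (fun t ht => key_pos N v hv v0 hc ht)
  rw [closure_Ioi] at this
  exact this ht

lemma P1_le (N : ℕ) (v : ℕ → ℝ) (hv : ∀ j, 0 ≤ v j) (v0 : v 0 = 1) (v1 : v 1 = 1) 
    (hc : ConcaveOn ℝ (Set.Ici 0) (fun t => (bs (N + 2) v t) ^ (1 / ((N : ℝ) + 2)))) {t : ℝ} (ht : 0 ≤ t) :
    bs (N + 2) v t ^ (1 / ((N : ℝ) + 2) - 1) * bs (N + 1) (sh v) t ≤ 1 := by
  have := h_anti N v hv v0 hc (Set.mem_Ici.2 le_rfl) ht ht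
  simpa [bs_at_zero, v0, v1, sh] using this

lemma P0_le (N : ℕ) (v : ℕ → ℝ) (hv : ∀ j, 0 ≤ v j) (v0 : v 0 = 1) (v1 : v 1 = 1) 
    (hc : ConcaveOn ℝ (Set.Ici 0) (fun t => (bs (N + 2) v t) ^ (1 / ((N : ℝ) + 2)))) {t : ℝ} (ht : 0 ≤ t) : bs (N + 2) v t ≤ (1 + t) ^ (N + 2) := by
  rcases ht.eq_or_lt with rfl | ht
  · simp [bs_at_zero, v0]
  have hp : 1 ≤ bs (N + 2) v t := v0 ▸ bs_ge_zero (N + 2) v hv ht.le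
  have h := hc.slope_le_of_hasDerivAt (Set.mem_Ici.2 le_rfl) ht.le ht (h_deriv N v hv v0 le_rfl)
  rw [slope_def_field, bs_at_zero, bs_at_zero] at h
  simp only [v0, sh, zero_add, v1, Real.one_rpow, sub_zero, mul_one] at h
  rw [div_le_one ht] at h
  have h' : bs (N + 2) v t ^ (1 / ((N : ℝ) + 2)) ≤ 1 + t := by linarith
  have h2 := pow_le_pow_left₀ (by positivity) h' (N + 2)
  rw [← Real.rpow_natCast, ← Real.rpow_mul (by positivity)] at h2
  push_cast at h2
  rwa [one_div_mul_cancel (by positivity), Real.rpow_one] at h2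

lemma P1_le' (N : ℕ) (v : ℕ → ℝ) (hv : ∀ j, 0 ≤ v j) (v0 : v 0 = 1) (v1 : v 1 = 1) 
    (hc : ConcaveOn ℝ (Set.Ici 0) (fun t => (bs (N + 2) v t) ^ (1 / ((N : ℝ) + 2)))) {t : ℝ} (ht : 0 ≤ t) : bs (N + 1) (sh v) t ≤ (1 + t) ^ (N + 1) := by
  have hp : 1 ≤ bs (N + 2) v t := v0 ▸ bs_ge_zero (N + 2) v hv ht
  have hp0 : 0 < bs (N + 2) v t := by linarith
  have h1 := P1_le N v hv v0 v1 hc ht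
  have h2 := P0_le N v hv v0 v1 hc ht
  set P0 := bs (N + 2) v t
  have h3 : bs (N + 1) (sh v) t ≤ P0 ^ (1 - 1 / ((N : ℝ) + 2)) := by
    have := mul_le_mul_of_nonneg_left h1 (Real.rpow_pos_of_pos hp0 (1 - 1 / ((N : ℝ) + 2))).le
    rw [← mul_assoc, ← Real.rpow_add hp0] at this
    simpa using this
  refine h3.trans ?_
  have h4 := Real.rpow_le_rpow hp0.le h2 (z := 1 - 1 / ((N : ℝ) + 2)) (by
    rw [sub_nonneg, div_le_one (by positivity)]; linarith [(Nat.cast_nonneg N : (0:ℝ) ≤ N)])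
  refine h4.trans (le_of_eq ?_)
  rw [← Real.rpow_natCast, ← Real.rpow_natCast, ← Real.rpow_mul (by positivity)]
  congr 1
  push_cast
  field_simp
  ring

end IterFen

namespace IterFen

lemma case2 (N : ℕ) (v : ℕ → ℝ) (hv : ∀ j, 0 ≤ v j) (v0 : v 0 = 1) (v1 : v 1 = 1)
    (hc : ConcaveOn ℝ (Set.Ici 0) (fun t => (bs (N + 2) v t) ^ (1 / ((N : ℝ) + 2)))) :
    v 2 ≤ 1 := by
  have := key N v hv v0 hc le_rfl
  simpa [bs_at_zero, sh, v0, v1] using this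

lemma gamma_eq (M : ℕ) (v : ℕ → ℝ) (t : ℝ) :
    bs (M + 1) (sh (sh v)) t = v 2 + (M + 1) * v 3 * t
      + ∑ i ∈ Finset.range M, ((M + 1).choose (i + 2) : ℝ) * v (i + 4) * t ^ (i + 2) := by
  unfold bs sh
  rw [Finset.sum_range_succ', Finset.sum_range_succ']
  simp
  ring

lemma beta_eq (M : ℕ) (v : ℕ → ℝ) (t : ℝ) :
    bs (M + 1) (sh v) t = v 1 + (M + 1) * v 2 * t + ((M + 1 : ℕ).choose 2 : ℝ) * v 3 * t ^ 2
      + ∑ i ∈ Finset.range M, ((M + 1).choose (i + 3) : ℝ) * v (i + 4) * t ^ (i + 3) := by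
  have : bs (M + 1) (sh v) t
      = ∑ j ∈ Finset.range (M + 3), ((M + 1).choose j : ℝ) * v (j + 1) * t ^ j := by
    rw [Finset.sum_range_succ _ (M + 2)]
    simp [bs, sh]
  rw [this, Finset.sum_range_succ', Finset.sum_range_succ', Finset.sum_range_succ']
  simp
  ring

lemma alpha_ge (M : ℕ) (v : ℕ → ℝ) (hv : ∀ j, 0 ≤ v j) {t : ℝ} (ht : 0 ≤ t) :
    v 0 + (M + 1) * v 1 * t + ((M + 1 : ℕ).choose 2 : ℝ) * v 2 * t ^ 2 ≤ bs (M + 1) v t := by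
  have : bs (M + 1) v t
      = ∑ j ∈ Finset.range (M + 3), ((M + 1).choose j : ℝ) * v j * t ^ j := by
    rw [Finset.sum_range_succ _ (M + 2)]
    simp [bs]
  rw [this, Finset.sum_range_succ', Finset.sum_range_succ', Finset.sum_range_succ']
  have : 0 ≤ ∑ i ∈ Finset.range M,
      ((M + 1).choose (i + 1 + 1 + 1) : ℝ) * v (i + 1 + 1 + 1) * t ^ (i + 1 + 1 + 1) :=
    Finset.sum_nonneg fun j _ => by have := hv (j + 1 + 1 + 1); positivity
  simp at this ⊢
  linarith

lemma rem_le (M : ℕ) (v : ℕ → ℝ) (hv : ∀ j, 0 ≤ v j) {t : ℝ} (ht : 0 ≤ t) :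
    ∑ i ∈ Finset.range M, ((M + 1).choose (i + 3) : ℝ) * v (i + 4) * t ^ (i + 3) ≤
    ((M + 1) * t / 2) *
      ∑ i ∈ Finset.range M, ((M + 1).choose (i + 2) : ℝ) * v (i + 4) * t ^ (i + 2) := by
  rw [Finset.mul_sum]
  apply Finset.sum_le_sum
  intro i _
  have h1 : ((M + 1).choose (i + 3) : ℝ) ≤ (M + 1) / 2 * ((M + 1).choose (i + 2) : ℝ) := by
    have h := Nat.choose_succ_right_eq (M + 1) (i + 2)
    have h2 : (M + 1).choose (i + 3) * 2 ≤ (M + 1) * (M + 1).choose (i + 2) := by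
      calc (M + 1).choose (i + 3) * 2 ≤ (M + 1).choose (i + 3) * (i + 2 + 1) :=
            Nat.mul_le_mul_left _ (by omega)
        _ = _ := h
        _ ≤ (M + 1).choose (i + 2) * (M + 1) := Nat.mul_le_mul_left _ (by omega)
        _ = _ := mul_comm _ _
    have h3 : (((M + 1).choose (i + 3) * 2 : ℕ) : ℝ) ≤ ((M + 1) * (M + 1).choose (i + 2) : ℕ) := by
      exact_mod_cast h2
    push_cast at h3
    linarith
  have h4 : 0 ≤ v (i + 4) * t ^ (i + 3) := by have := hv (i + 4); positivity
  calc _ = ((M + 1).choose (i + 3) : ℝ) * (v (i + 4) * t ^ (i + 3)) := by ring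
    _ ≤ ((M + 1) / 2 * ((M + 1).choose (i + 2) : ℝ)) * (v (i + 4) * t ^ (i + 3)) := by gcongr
    _ = _ := by ring

lemma case3_core (x y a R al be ga : ℝ) (hx : 0 < x) (hy : 0 ≤ y) (hyx : y ≤ x)
    (hR : 0 ≤ R) (hal : 1 + x + a * (x * y / 2) ≤ al) (hga : ga = a + 16 / 9 * x + R)
    (hbe0 : 0 ≤ be) (hbe : be ≤ 1 + a * x + 16 / 9 * (x * y / 2) + x / 2 * R)
    (hB : be ≤ (1 + x) * 2) (hk : al * ga ≤ be ^ 2) (ha0 : 0 ≤ a) (ha1 : a ≤ 1)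
    (hxx : (x = 13 / 20 ∧ a ≤ 1 / 2) ∨ (x = 1 / 2 ∧ 1 / 2 ≤ a)) : False := by
  set b0 := 1 + a * x + 16 / 9 * (x * y / 2) with hb0
  set aT := 1 + x + a * (x * y / 2) with haT
  have hxy : 0 ≤ x * y / 2 := by positivity
  have hga0 : 0 ≤ ga := by rw [hga]; positivity
  have hb0p : 0 ≤ b0 := by positivity
  have hs : x / 2 * (be + b0) ≤ aT := by
    rw [haT, hb0] at *
    rcases hxx with ⟨rfl, h⟩ | ⟨rfl, h⟩ <;> nlinarith
  have h1 : aT * ga ≤ be ^ 2 := le_trans (by gcongr) hk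
  have h2 : be ^ 2 ≤ b0 ^ 2 + R * aT := by
    by_cases hbb : be ≤ b0
    · have : be ^ 2 ≤ b0 ^ 2 := by gcongr
      have : 0 ≤ R * aT := by positivity
      linarith
    · push Not at hbb
      have h3 : be ^ 2 - b0 ^ 2 ≤ x / 2 * R * (be + b0) := by
        have : (be - b0) * (be + b0) ≤ (x / 2 * R) * (be + b0) := by
          apply mul_le_mul_of_nonneg_right _ (by positivity)
          linarith
        nlinarith
      have h4 : R * (x / 2 * (be + b0)) ≤ R * aT := by gcongr
      nlinarith
  have h5 : aT * (a + 16 / 9 * x) ≤ b0 ^ 2 := by rw [hga] at h1; nlinarith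
  rw [haT, hb0] at h5
  clear h1 h2 hs hB hk hbe hal hga hb0p hga0
  clear_value b0 aT
  clear hb0 haT
  rcases hxx with ⟨rfl, h⟩ | ⟨rfl, h⟩
  · obtain ⟨z, rfl⟩ : ∃ z, y = 13 / 20 - z := ⟨13 / 20 - y, by ring⟩
    have hz : 0 ≤ z := by linarith
    nlinarith [mul_nonneg ha0 hz, mul_nonneg ha0 hy, mul_nonneg ha0 (sub_nonneg.2 h),
      mul_nonneg hz hy, mul_nonneg (mul_nonneg ha0 hz) (sub_nonneg.2 h),
      mul_nonneg hz (sub_nonneg.2 h), mul_nonneg hy (sub_nonneg.2 h)]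
  · obtain ⟨z, rfl⟩ : ∃ z, y = 1 / 2 - z := ⟨1 / 2 - y, by ring⟩
    have hz : 0 ≤ z := by linarith
    nlinarith [mul_nonneg ha0 hz, mul_nonneg ha0 hy, mul_nonneg (sub_nonneg.2 ha1) (sub_nonneg.2 h),
      mul_nonneg hz hy, mul_nonneg (mul_nonneg ha0 hz) (sub_nonneg.2 h),
      mul_nonneg hz (sub_nonneg.2 h), mul_nonneg hy (sub_nonneg.2 h), mul_nonneg hz (sub_nonneg.2 ha1)]

lemma case3 (M : ℕ) (v : ℕ → ℝ) (hv : ∀ j, 0 ≤ v j) (v0 : v 0 = 1) (v1 : v 1 = 1)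
    (hc : ConcaveOn ℝ (Set.Ici 0)
      (fun t => (bs (M + 1 + 2) v t) ^ (1 / (((M + 1 : ℕ) : ℝ) + 2)))) :
    v 3 ≤ 16 / 9 := by
  by_contra hcon
  push Not at hcon
  have ha1 := case2 (M + 1) v hv v0 v1 hc
  obtain ⟨x, hxx⟩ : ∃ x : ℝ, (x = 13 / 20 ∧ v 2 ≤ 1 / 2) ∨ (x = 1 / 2 ∧ 1 / 2 ≤ v 2) := by
    rcases le_total (v 2) (1 / 2) with h | h
    · exact ⟨_, Or.inl ⟨rfl, h⟩⟩
    · exact ⟨_, Or.inr ⟨rfl, h⟩⟩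
  have hx : 0 < x := by rcases hxx with ⟨rfl, _⟩ | ⟨rfl, _⟩ <;> norm_num
  have hx2 : x ≤ 13 / 20 := by rcases hxx with ⟨rfl, _⟩ | ⟨rfl, _⟩ <;> norm_num
  set t : ℝ := x / (M + 1) with ht
  have hMt : (M + 1 : ℝ) * t = x := by rw [ht]; field_simp
  have ht0 : 0 ≤ t := by positivity
  have htx : t ≤ x := by rw [ht]; apply div_le_self hx.le; linarith [(Nat.cast_nonneg M : (0:ℝ) ≤ M)]
  have hch : (((M + 1 : ℕ).choose 2 : ℕ) : ℝ) * t ^ 2 = x * (x - t) / 2 := by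
    rw [Nat.cast_choose_two]; push_cast
    rw [← hMt]; ring
  have hk := key (M + 1) v hv v0 hc ht0
  have hB := P1_le' (M + 1) v hv v0 v1 hc ht0
  rw [bs_succ, bs_succ] at hk
  rw [bs_succ (M + 1) (sh v)] at hk hB
  have hal := alpha_ge M v hv ht0
  have hga := gamma_eq M v t
  have hbe := beta_eq M v t
  have hrem := rem_le M v hv ht0
  have hR0 : 0 ≤ ∑ i ∈ Finset.range M, ((M + 1).choose (i + 2) : ℝ) * v (i + 4) * t ^ (i + 2) :=
    Finset.sum_nonneg fun j _ => by have := hv (j + 4); positivity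
  have hbe0 := bs_nonneg (M + 1) (sh v) (fun j => hv _) ht0
  have hga0 := bs_nonneg (M + 1) (sh (sh v)) (fun j => hv _) ht0
  set al := bs (M + 1) v t
  set be := bs (M + 1) (sh v) t
  set ga := bs (M + 1) (sh (sh v)) t
  set Rg := ∑ i ∈ Finset.range M, ((M + 1).choose (i + 2) : ℝ) * v (i + 4) * t ^ (i + 2)
  set Rb := ∑ i ∈ Finset.range M, ((M + 1).choose (i + 3) : ℝ) * v (i + 4) * t ^ (i + 3)
  have hexp : (1 + t) ^ (M + 1 + 1) ≤ (1 + x) * 2 := by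
    rw [pow_succ, mul_comm]
    have : (1 + t) ^ (M + 1) ≤ 2 := by
      calc (1 + t) ^ (M + 1) ≤ (Real.exp t) ^ (M + 1) := by
            gcongr; linarith [Real.add_one_le_exp t]
        _ = Real.exp x := by rw [← Real.exp_nat_mul]; push_cast; rw [hMt]
        _ ≤ Real.exp (Real.log 2) := by
            apply Real.exp_le_exp.2; linarith [Real.log_two_gt_d9]
        _ = 2 := Real.exp_log (by norm_num)
    gcongr
  refine case3_core x (x - t) (v 2) ((v 3 - 16 / 9) * x + Rg) al be ga hx (by linarith)
    (by linarith) ?_ ?_ ?_ hbe0 ?_ ?_ ?_ (hv 2) ha1 hxx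
  · have : 0 ≤ (v 3 - 16 / 9) * x := mul_nonneg (by linarith) hx.le
    linarith
  · refine le_trans (le_of_eq ?_) hal
    rw [v0, v1, mul_right_comm _ (v 2), hch]
    linear_combination -hMt
  · rw [hga]; linear_combination (v 3) * hMt
  · rw [hbe, v1, mul_right_comm _ (v 3), hch]
    have e1 : (M + 1 : ℝ) * v 2 * t = v 2 * x := by rw [← hMt]; ring
    rw [hMt] at hrem
    rw [e1]
    nlinarith [mul_nonneg (mul_nonneg (sub_nonneg.2 hcon.le) hx.le) ht0]
  · have : 0 ≤ t * ga := mul_nonneg ht0 hga0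
    linarith
  · nlinarith

lemma growth (q m : ℕ) : ((q + m : ℕ) : ℝ) ^ (q + m) * q.factorial
    ≤ Real.exp 1 ^ m * (q : ℝ) ^ q * (q + m).factorial := by
  induction m with
  | zero => simp
  | succ m ih =>
    have h : ∀ k : ℕ, ((k + 1 : ℕ) : ℝ) ^ k ≤ Real.exp 1 * (k : ℝ) ^ k := by
      intro k
      rcases Nat.eq_zero_or_pos k with rfl | hk
      · simp
      have hk' : (0 : ℝ) < k := by exact_mod_cast hk
      have h1 : ((k + 1 : ℕ) : ℝ) = k * (1 + 1 / k) := by push_cast; field_simp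
      rw [h1, mul_pow, mul_comm]
      gcongr
      calc (1 + 1 / (k : ℝ)) ^ k ≤ (Real.exp (1 / k)) ^ k := by
            gcongr; linarith [Real.add_one_le_exp (1 / (k : ℝ))]
        _ = Real.exp 1 := by rw [← Real.exp_nat_mul]; congr 1; field_simp
    rw [← add_assoc, pow_succ, Nat.factorial_succ (q + m), pow_succ (Real.exp 1)]
    set k := q + m
    have hk := h k
    calc ((k + 1 : ℕ) : ℝ) ^ k * ((k + 1 : ℕ) : ℝ) * q.factorial
        ≤ (Real.exp 1 * (k : ℝ) ^ k) * ((k + 1 : ℕ) : ℝ) * q.factorial := by gcongr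
      _ = Real.exp 1 * ((k + 1 : ℕ) : ℝ) * ((k : ℝ) ^ k * q.factorial) := by ring
      _ ≤ Real.exp 1 * ((k + 1 : ℕ) : ℝ) * (Real.exp 1 ^ m * (q : ℝ) ^ q * k.factorial) := by gcongr
      _ = _ := by push_cast; ring

lemma exp_le_two (m : ℕ) (hm : 4 ≤ m) : Real.exp 1 ^ m ≤ 2 ^ (m * (m - 1) / 2) := by
  have he := Real.exp_one_lt_d9
  induction m, hm using Nat.le_induction with
  | base =>
    calc Real.exp 1 ^ 4 ≤ (2.72 : ℝ) ^ 4 := by gcongr; linarith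
      _ ≤ _ := by norm_num
  | succ k hk ih =>
    have : (k + 1) * (k + 1 - 1) / 2 = k * (k - 1) / 2 + k := by
      rw [← Nat.choose_two_right, ← Nat.choose_two_right, Nat.choose_succ_succ]
      simp; ring
    rw [this, pow_succ, pow_add]
    gcongr
    calc Real.exp 1 ≤ 2 ^ 2 := by linarith
      _ ≤ 2 ^ k := pow_le_pow_right₀ (by norm_num) (by omega)

lemma case4 (N m : ℕ) (hm : 4 ≤ m) (hmn : m ≤ N + 2)
    (v : ℕ → ℝ) (hv : ∀ j, 0 ≤ v j) (v0 : v 0 = 1) (v1 : v 1 = 1)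
    (hc : ConcaveOn ℝ (Set.Ici 0) (fun t => (bs (N + 2) v t) ^ (1 / ((N : ℝ) + 2)))) :
    v m * (m : ℝ) ^ m ≤ 2 ^ (m * (m - 1) / 2) * m.factorial := by
  have hb : ∀ t : ℝ, 0 ≤ t → ((N + 2).choose m : ℝ) * v m * t ^ m ≤ (1 + t) ^ (N + 2) := by
    intro t ht
    refine le_trans ?_ (P0_le N v hv v0 v1 hc ht)
    unfold bs
    exact Finset.single_le_sum (f := fun j => ((N + 2).choose j : ℝ) * v j * t ^ j)
      (fun j _ => by have := hv j; positivity) (Finset.mem_range.2 (by omega))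
  obtain ⟨q, hq⟩ : ∃ q, N + 2 = q + m := ⟨N + 2 - m, by omega⟩
  have hmpos : (0 : ℝ) < m := by exact_mod_cast (by omega : 0 < m)
  rw [hq] at hb
  have h1 : ((q + m).choose m : ℝ) * v m * (m : ℝ) ^ m * (q : ℝ) ^ q
      ≤ ((q + m : ℕ) : ℝ) ^ (q + m) := by
    rcases Nat.eq_zero_or_pos q with rfl | hqp
    · simp only [zero_add, Nat.choose_self, Nat.cast_one, one_mul, Nat.cast_zero, pow_zero, mul_one]
        at hb ⊢
      have hvm : v m ≤ 1 := by
        have hlim : Filter.Tendsto (fun k : ℕ => (1 + 1 / ((k : ℝ) + 1)) ^ m) Filter.atTop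
            (nhds ((1 + 0) ^ m)) :=
          (tendsto_one_div_add_atTop_nhds_zero_nat.const_add 1).pow m
        rw [add_zero, one_pow] at hlim
        refine ge_of_tendsto' hlim fun k => ?_
        have hk : (0 : ℝ) < (k : ℝ) + 1 := by positivity
        have := hb (k + 1) hk.le
        have e : (1 + 1 / ((k : ℝ) + 1)) ^ m = (1 + ((k : ℝ) + 1)) ^ m / ((k : ℝ) + 1) ^ m := by
          rw [← div_pow]; congr 1; field_simp; ring
        rw [e, le_div_iff₀ (by positivity)]
        exact this
      calc v m * (m : ℝ) ^ m ≤ 1 * (m : ℝ) ^ m := by gcongr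
        _ = _ := one_mul _
    · have hq0 : (0 : ℝ) < q := by exact_mod_cast hqp
      have := hb (m / q) (by positivity)
      have e : (1 + (m : ℝ) / q) = ((q + m : ℕ) : ℝ) / q := by push_cast; field_simp
      rw [e, div_pow, div_pow, le_div_iff₀ (by positivity)] at this
      refine le_trans (le_of_eq ?_) this
      rw [pow_add]; field_simp
  have h2 := growth q m
  have h3 : ((q + m).choose m : ℝ) * q.factorial * m.factorial = (q + m).factorial := by
    have := Nat.add_choose_mul_factorial_mul_factorial q m
    exact_mod_cast this
  have hqq : (0 : ℝ) < (q : ℝ) ^ q := by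
    rcases Nat.eq_zero_or_pos q with rfl | hqp
    · simp
    · positivity
  have hf : (0 : ℝ) < (q + m).factorial := by positivity
  have h4 : (v m * (m : ℝ) ^ m) * ((q : ℝ) ^ q * (q + m).factorial)
      ≤ (Real.exp 1 ^ m * m.factorial) * ((q : ℝ) ^ q * (q + m).factorial) := by
    calc _ = (((q + m).choose m : ℝ) * v m * (m : ℝ) ^ m * (q : ℝ) ^ q)
          * (q.factorial * m.factorial) := by rw [← h3]; ring
      _ ≤ ((q + m : ℕ) : ℝ) ^ (q + m) * (q.factorial * m.factorial) := by gcongr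
      _ = (((q + m : ℕ) : ℝ) ^ (q + m) * q.factorial) * m.factorial := by ring
      _ ≤ (Real.exp 1 ^ m * (q : ℝ) ^ q * (q + m).factorial) * m.factorial := by gcongr
      _ = _ := by ring
  have h5 := le_of_mul_le_mul_right h4 (by positivity)
  refine h5.trans ?_
  gcongr
  exact exp_le_two m hm

lemma analytic (n m : ℕ) (hm : 2 ≤ m) (hmn : m ≤ n)
    (v : ℕ → ℝ) (hv : ∀ j, 0 ≤ v j) (v0 : v 0 = 1) (v1 : v 1 = 1)
    (hc : ConcaveOn ℝ (Set.Ici 0) (fun t => (bs n v t) ^ (1 / (n : ℝ)))) :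
    v m * (m : ℝ) ^ m ≤ 2 ^ (m * (m - 1) / 2) * m.factorial := by
  obtain ⟨N, rfl⟩ : ∃ N, n = N + 2 := ⟨n - 2, by omega⟩
  push_cast at hc
  rcases (by omega : m = 2 ∨ m = 3 ∨ 4 ≤ m) with rfl | rfl | h
  · have := case2 N v hv v0 v1 hc
    norm_num [Nat.factorial]; linarith
  · obtain ⟨M, rfl⟩ : ∃ M, N = M + 1 := ⟨N - 1, by omega⟩
    have := case3 M v hv v0 v1 hc
    norm_num [Nat.factorial]; linarith
  · exact case4 N m h hmn v hv v0 v1 hc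

end IterFen

namespace IterFen
open scoped ENNReal

lemma bm1_compact {A B : Set ℝ} (hA : IsCompact A) (hB : IsCompact B) (hA' : A.Nonempty)
    (hB' : B.Nonempty) : volume A + volume B ≤ volume (A + B) := by
  obtain ⟨a, haA, ha⟩ := hA.exists_isGreatest hA'
  obtain ⟨b, hbB, hb⟩ := hB.exists_isLeast hB'
  have h1 : (b +ᵥ A) ⊆ A + B := by
    rintro _ ⟨x, hx, rfl⟩
    exact ⟨x, hx, b, hbB, by simp [add_comm]⟩
  have h2 : (a +ᵥ B) ⊆ A + B := by
    rintro _ ⟨x, hx, rfl⟩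
    exact ⟨a, haA, x, hx, by simp⟩
  have hd : AEDisjoint volume (b +ᵥ A) (a +ᵥ B) := by
    have : (b +ᵥ A) ∩ (a +ᵥ B) ⊆ {a + b} := by
      rintro z ⟨⟨x, hx, rfl⟩, ⟨y, hy, hxy⟩⟩
      have h3 := ha hx
      have h4 := hb hy
      simp only [vadd_eq_add, Set.mem_singleton_iff] at hxy ⊢
      linarith
    exact measure_mono_null this (by simp)
  have hm : MeasurableSet (a +ᵥ B) := (hB.vadd a).measurableSet
  calc volume A + volume B = volume (b +ᵥ A) + volume (a +ᵥ B) := by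
        rw [measure_vadd, measure_vadd]
    _ = volume ((b +ᵥ A) ∪ (a +ᵥ B)) := (measure_union₀ hm.nullMeasurableSet hd).symm
    _ ≤ _ := measure_mono (Set.union_subset h1 h2)

lemma bm1 {A B C : Set ℝ} (hA : MeasurableSet A) (hB : MeasurableSet B) (hA' : A.Nonempty)
    (hB' : B.Nonempty) {l : ℝ} (h0 : 0 < l) (h1 : l < 1)
    (hC : ∀ x ∈ A, ∀ y ∈ B, l * x + (1 - l) * y ∈ C) :
    ENNReal.ofReal l * volume A + ENNReal.ofReal (1 - l) * volume B ≤ volume C := by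
  obtain ⟨a, ha⟩ := hA'
  obtain ⟨b, hb⟩ := hB'
  have key : ∀ K ⊆ A, IsCompact K → ∀ K' ⊆ B, IsCompact K' →
      ENNReal.ofReal l * volume K + ENNReal.ofReal (1 - l) * volume K' ≤ volume C := by
    intro K hKA hK K' hKB hK'
    have h := bm1_compact ((hK.insert a).smul l) ((hK'.insert b).smul (1 - l))
      ((Set.insert_nonempty _ _).smul_set) ((Set.insert_nonempty _ _).smul_set)
    rw [Measure.addHaar_smul, Measure.addHaar_smul] at h
    simp only [Module.finrank_self, pow_one, abs_of_pos h0, abs_of_pos (sub_pos.2 h1)] at h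
    calc _ ≤ ENNReal.ofReal l * volume (insert a K) + ENNReal.ofReal (1 - l) * volume (insert b K')
          := by gcongr <;> simp
      _ ≤ _ := h
      _ ≤ volume C := by
          apply measure_mono
          rintro _ ⟨_, ⟨x, hx, rfl⟩, _, ⟨y, hy, rfl⟩, rfl⟩
          refine hC x ?_ y ?_
          · rcases hx with rfl | hx
            exacts [ha, hKA hx]
          · rcases hy with rfl | hy
            exacts [hb, hKB hy]
  rw [hA.measure_eq_iSup_isCompact, hB.measure_eq_iSup_isCompact]
  simp only [iSup_and', ENNReal.mul_iSup]
  exact ENNReal.biSup_add_biSup_le' ⟨∅, Set.empty_subset _, isCompact_empty⟩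
    ⟨∅, Set.empty_subset _, isCompact_empty⟩ fun K hK K' hK' => key K hK.1 hK.2 K' hK'.1 hK'.2

/-- The Prekopa-Leindler property. -/
def PL (E : Type) [AddCommGroup E] [Module ℝ E] [MeasureSpace E] : Prop :=
  ∀ (l : ℝ), 0 < l → l < 1 → ∀ f g h : E → ℝ≥0∞, Measurable f → Measurable g → Measurable h →
    (∀ x y, f x ^ l * g y ^ (1 - l) ≤ h (l • x + (1 - l) • y)) →
    (∫⁻ x, f x) ^ l * (∫⁻ x, g x) ^ (1 - l) ≤ ∫⁻ x, h x

lemma amgm (l : ℝ) (h0 : 0 < l) (h1 : l < 1) (x y : ℝ≥0∞) :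
    x ^ l * y ^ (1 - l) ≤ ENNReal.ofReal l * x + ENNReal.ofReal (1 - l) * y := by
  have hpq : (l⁻¹).HolderConjugate (1 - l)⁻¹ := by
    rw [Real.holderConjugate_iff]
    refine ⟨(one_lt_inv₀ h0).2 h1, by simp⟩
  have h1' : 0 < 1 - l := sub_pos.2 h1
  have := ENNReal.young_inequality (x ^ l) (y ^ (1 - l)) hpq
  rw [← ENNReal.rpow_mul, ← ENNReal.rpow_mul, mul_inv_cancel₀ h0.ne', mul_inv_cancel₀ h1'.ne',
    ENNReal.rpow_one, ENNReal.rpow_one, ENNReal.div_eq_inv_mul, ENNReal.div_eq_inv_mul,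
    ENNReal.ofReal_inv_of_pos h0, ENNReal.ofReal_inv_of_pos h1', inv_inv, inv_inv] at this
  exact this

lemma layer (f : ℝ → ℝ≥0∞) (hf : Measurable f) (hf1 : ∀ x, f x ≤ 1) :
    ∫⁻ x, f x = ∫⁻ t in Set.Ioi (0 : ℝ), volume {x | ENNReal.ofReal t < f x} := by
  have hfin : ∀ x, f x ≠ ⊤ := fun x => ((hf1 x).trans_lt (by simp)).ne
  have := lintegral_eq_lintegral_meas_lt (volume : Measure ℝ) (f := fun x => (f x).toReal)
    (Filter.Eventually.of_forall fun x => ENNReal.toReal_nonneg) hf.ennreal_toReal.aemeasurable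
  simp only [ENNReal.ofReal_toReal (hfin _)] at this
  rw [this]
  apply setLIntegral_congr_fun measurableSet_Ioi
  intro t ht
  simp only
  congr 1
  ext x
  simp [ENNReal.ofReal_lt_iff_lt_toReal (le_of_lt ht) (hfin x)]

lemma pl1_norm {l : ℝ} (h0 : 0 < l) (h1 : l < 1) (f g h : ℝ → ℝ≥0∞) (hf : Measurable f)
    (hg : Measurable g) (hh : Measurable h) (hf1 : ⨆ x, f x = 1) (hg1 : ⨆ x, g x = 1)
    (hfgh : ∀ x y, f x ^ l * g y ^ (1 - l) ≤ h (l • x + (1 - l) • y)) :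
    ENNReal.ofReal l * (∫⁻ x, f x) + ENNReal.ofReal (1 - l) * (∫⁻ x, g x) ≤ ∫⁻ x, h x := by
  have hfle : ∀ x, f x ≤ 1 := fun x => hf1 ▸ le_iSup f x
  have hgle : ∀ x, g x ≤ 1 := fun x => hg1 ▸ le_iSup g x
  have h1' : 0 < 1 - l := sub_pos.2 h1
  have hmono : ∀ u : ℝ → ℝ≥0∞, Measurable (fun t : ℝ => volume {x | ENNReal.ofReal t < u x}) := by
    intro u
    apply Antitone.measurable
    intro s t hst
    exact measure_mono fun x hx => lt_of_le_of_lt (ENNReal.ofReal_le_ofReal hst) hx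
  calc _ = ENNReal.ofReal l * (∫⁻ t in Set.Ioi (0 : ℝ), volume {x | ENNReal.ofReal t < f x})
        + ENNReal.ofReal (1 - l) * (∫⁻ t in Set.Ioi (0 : ℝ), volume {x | ENNReal.ofReal t < g x}) := by
        rw [layer f hf hfle, layer g hg hgle]
    _ = ∫⁻ t in Set.Ioi (0 : ℝ), (ENNReal.ofReal l * volume {x | ENNReal.ofReal t < f x}
        + ENNReal.ofReal (1 - l) * volume {x | ENNReal.ofReal t < g x}) := by
        rw [lintegral_add_left ((hmono f).const_mul _), lintegral_const_mul _ (hmono f),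
          lintegral_const_mul _ (hmono g)]
    _ ≤ ∫⁻ t in Set.Ioi (0 : ℝ), volume {x | ENNReal.ofReal t < min (h x) 1} := by
        apply setLIntegral_mono (hmono _)
        intro t ht
        rcases lt_or_ge t 1 with h | h
        · have ht1 : ENNReal.ofReal t < 1 := by simpa using h
          have hfn : {x | ENNReal.ofReal t < f x}.Nonempty := by
            obtain ⟨x, hx⟩ := lt_iSup_iff.1 (show ENNReal.ofReal t < ⨆ x, f x by rw [hf1]; exact ht1)
            exact ⟨x, hx⟩
          have hgn : {x | ENNReal.ofReal t < g x}.Nonempty := by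
            obtain ⟨x, hx⟩ := lt_iSup_iff.1 (show ENNReal.ofReal t < ⨆ x, g x by rw [hg1]; exact ht1)
            exact ⟨x, hx⟩
          refine bm1 (measurableSet_lt measurable_const hf) (measurableSet_lt measurable_const hg)
            hfn hgn h0 h1 ?_
          intro x hx y hy
          refine lt_min (lt_of_lt_of_le ?_ (hfgh x y)) ht1
          have e : ENNReal.ofReal t = ENNReal.ofReal t ^ l * ENNReal.ofReal t ^ (1 - l) := by
            rw [← ENNReal.rpow_add _ _ (by simpa using ht) (by simp)]; simp
          rw [e]
          exact ENNReal.mul_lt_mul (ENNReal.rpow_lt_rpow hx h0) (ENNReal.rpow_lt_rpow hy h1')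
        · have ht1 : 1 ≤ ENNReal.ofReal t := by simpa using h
          have e1 : {x | ENNReal.ofReal t < f x} = ∅ := by
            ext x; simpa using (hfle x).trans ht1
          have e2 : {x | ENNReal.ofReal t < g x} = ∅ := by
            ext x; simpa using (hgle x).trans ht1
          simp [e1, e2]
    _ = ∫⁻ x, min (h x) 1 := (layer _ (hh.min measurable_const) (fun x => min_le_right _ _)).symm
    _ ≤ _ := lintegral_mono fun x => min_le_left _ _

lemma pl1_bdd {l : ℝ} (h0 : 0 < l) (h1 : l < 1) (f g h : ℝ → ℝ≥0∞) (hf : Measurable f)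
    (hg : Measurable g) (hh : Measurable h) (hf1 : ⨆ x, f x ≠ ⊤) (hg1 : ⨆ x, g x ≠ ⊤)
    (hfgh : ∀ x y, f x ^ l * g y ^ (1 - l) ≤ h (l • x + (1 - l) • y)) :
    (∫⁻ x, f x) ^ l * (∫⁻ x, g x) ^ (1 - l) ≤ ∫⁻ x, h x := by
  have h1' : 0 < 1 - l := sub_pos.2 h1
  set a := ⨆ x, f x with ha
  set b := ⨆ x, g x with hb
  by_cases ha0 : a = 0
  · have : ∀ x, f x = 0 := fun x => le_antisymm (ha0 ▸ le_iSup f x) bot_le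
    simp [this, h0]
  by_cases hb0 : b = 0
  · have : ∀ x, g x = 0 := fun x => le_antisymm (hb0 ▸ le_iSup g x) bot_le
    simp [this, h1']
  have hal0 : a ^ l ≠ 0 := by simp [ha0, h0, h0.le]
  have hat : a ^ l ≠ ⊤ := by simp [hf1, h0.le]
  have hbl0 : b ^ (1 - l) ≠ 0 := by simp [hb0, h1', h1.le]
  have hbt : b ^ (1 - l) ≠ ⊤ := by simp [hg1, h1.le]
  have hn := pl1_norm h0 h1 (fun x => a⁻¹ * f x) (fun x => b⁻¹ * g x)
    (fun x => (a ^ l * b ^ (1 - l))⁻¹ * h x) (hf.const_mul _) (hg.const_mul _) (hh.const_mul _)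
    (by rw [← ENNReal.mul_iSup, ← ha, ENNReal.inv_mul_cancel ha0 hf1])
    (by rw [← ENNReal.mul_iSup, ← hb, ENNReal.inv_mul_cancel hb0 hg1])
    (by
      intro x y
      rw [ENNReal.mul_rpow_of_nonneg _ _ h0.le, ENNReal.mul_rpow_of_nonneg _ _ h1'.le,
        ENNReal.mul_inv (Or.inl hal0) (Or.inl hat), ENNReal.inv_rpow, ENNReal.inv_rpow]
      calc _ = (a ^ l)⁻¹ * (b ^ (1 - l))⁻¹ * (f x ^ l * g y ^ (1 - l)) := by ring
        _ ≤ _ := by gcongr; exact hfgh x y)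
  have h2 := (amgm l h0 h1 _ _).trans hn
  rw [lintegral_const_mul _ hf, lintegral_const_mul _ hg, lintegral_const_mul _ hh,
    ENNReal.mul_rpow_of_nonneg _ _ h0.le, ENNReal.mul_rpow_of_nonneg _ _ h1'.le,
    ENNReal.inv_rpow, ENNReal.inv_rpow] at h2
  have hc0 : a ^ l * b ^ (1 - l) ≠ 0 := mul_ne_zero hal0 hbl0
  have hct : a ^ l * b ^ (1 - l) ≠ ⊤ := ENNReal.mul_ne_top hat hbt
  have h3 : (a ^ l * b ^ (1 - l))⁻¹ * ((∫⁻ x, f x) ^ l * (∫⁻ x, g x) ^ (1 - l))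
      ≤ (a ^ l * b ^ (1 - l))⁻¹ * ∫⁻ x, h x := by
    refine le_trans (le_of_eq ?_) h2
    rw [ENNReal.mul_inv (Or.inl hal0) (Or.inl hat)]
    ring
  exact (ENNReal.mul_le_mul_iff_right (ENNReal.inv_ne_zero.2 hct) (ENNReal.inv_ne_top.2 hc0)).1 h3

lemma trunc_lim (f : ℝ → ℝ≥0∞) (hf : Measurable f) :
    Filter.Tendsto (fun k : ℕ => ∫⁻ x, min (f x) k) Filter.atTop (nhds (∫⁻ x, f x)) := by
  apply lintegral_tendsto_of_tendsto_of_monotone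
  · exact fun k => (hf.min measurable_const).aemeasurable
  · refine Filter.Eventually.of_forall fun x i j hij => ?_
    exact min_le_min le_rfl (by exact_mod_cast hij)
  · refine Filter.Eventually.of_forall fun x => ?_
    have := (tendsto_const_nhds (x := f x)).min ENNReal.tendsto_nat_nhds_top
    simpa using this

lemma pl1 : PL ℝ := by
  intro l h0 h1 f g h hf hg hh hfgh
  have h1' : 0 < 1 - l := sub_pos.2 h1
  by_cases ha : ∫⁻ x, f x = 0
  · simp [ha, h0]
  by_cases hb : ∫⁻ x, g x = 0
  · simp [hb, h1']
  have hlim : Filter.Tendsto (fun k : ℕ => (∫⁻ x, min (f x) k) ^ l * (∫⁻ x, min (g x) k) ^ (1 - l))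
      Filter.atTop (nhds ((∫⁻ x, f x) ^ l * (∫⁻ x, g x) ^ (1 - l))) := by
    apply ENNReal.Tendsto.mul
    · exact ((ENNReal.continuous_rpow_const).tendsto _).comp (trunc_lim f hf)
    · left; simp [ha, h0, h0.le]
    · exact ((ENNReal.continuous_rpow_const).tendsto _).comp (trunc_lim g hg)
    · left; simp [hb, h1', h1.le]
  refine le_of_tendsto' hlim fun k => ?_
  apply pl1_bdd h0 h1 _ _ h (hf.min measurable_const) (hg.min measurable_const) hh
  · exact ((iSup_le fun x => min_le_right _ _).trans_lt (ENNReal.natCast_lt_top k)).ne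
  · exact ((iSup_le fun x => min_le_right _ _).trans_lt (ENNReal.natCast_lt_top k)).ne
  · intro x y
    refine le_trans ?_ (hfgh x y)
    gcongr <;> exact min_le_left _ _

lemma pl_prod {X Y : Type} [AddCommGroup X] [Module ℝ X] [MeasureSpace X] [AddCommGroup Y]
    [Module ℝ Y] [MeasureSpace Y] [SFinite (volume : Measure X)] [SFinite (volume : Measure Y)]
    (hX : PL X) (hY : PL Y) : PL (X × Y) := by
  intro l h0 h1 f g h hf hg hh hfgh
  change (∫⁻ x, f x ∂(volume.prod volume)) ^ l * (∫⁻ x, g x ∂(volume.prod volume)) ^ (1 - l)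
    ≤ ∫⁻ x, h x ∂(volume.prod volume)
  rw [lintegral_prod _ hf.aemeasurable, lintegral_prod _ hg.aemeasurable,
    lintegral_prod _ hh.aemeasurable]
  apply hX l h0 h1 _ _ _ hf.lintegral_prod_right' hg.lintegral_prod_right' hh.lintegral_prod_right'
  intro x x'
  apply hY l h0 h1 _ _ _ (hf.comp measurable_prodMk_left) (hg.comp measurable_prodMk_left)
    (hh.comp measurable_prodMk_left)
  intro y y'
  exact hfgh (x, y) (x', y')

lemma pl_equiv {X Y : Type} [AddCommGroup X] [Module ℝ X] [MeasureSpace X] [AddCommGroup Y]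
    [Module ℝ Y] [MeasureSpace Y] (e : X ≃ᵐ Y) (he : MeasurePreserving e)
    (hl : ∀ (a b : ℝ) (x y : X), e (a • x + b • y) = a • e x + b • e y) (hX : PL X) : PL Y := by
  intro l h0 h1 f g h hf hg hh hfgh
  rw [← he.lintegral_comp hf, ← he.lintegral_comp hg, ← he.lintegral_comp hh]
  apply hX l h0 h1 _ _ _ (hf.comp e.measurable) (hg.comp e.measurable) (hh.comp e.measurable)
  intro x y
  have := hfgh (e x) (e y)
  rwa [← hl] at this

lemma pl_pi (n : ℕ) : PL (Fin n → ℝ) := by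
  induction n with
  | zero =>
    intro l h0 h1 f g h hf hg hh hfgh
    have := hfgh default default
    have e : ∀ u : (Fin 0 → ℝ) → ℝ≥0∞, ∫⁻ x, u x = u default := by
      intro u; rw [volume_pi, Measure.pi_of_empty _ default, lintegral_dirac]
    rw [e, e, e]
    convert this
  | succ n ih =>
    refine pl_equiv (MeasurableEquiv.piFinSuccAbove (fun _ => ℝ) 0).symm
      (volume_preserving_piFinSuccAbove (fun _ => ℝ) 0).symm ?_ (pl_prod pl1 ih)
    intro a b x y
    ext i
    refine Fin.cases ?_ (fun j => ?_) i <;>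
    simp [MeasurableEquiv.piFinSuccAbove]

lemma pl_euc (n : ℕ) : PL (EuclideanSpace ℝ (Fin n)) := by
  refine pl_equiv (MeasurableEquiv.toLp 2 (Fin n → ℝ))
    (PiLp.volume_preserving_toLp (Fin n)) ?_ (pl_pi n)
  intro a b x y
  rfl

end IterFen

namespace IterFen
open scoped ENNReal

lemma bm_mult {n : ℕ} {X Y : Set (EuclideanSpace ℝ (Fin n))} (hX : IsCompact X) (hY : IsCompact Y)
    {l : ℝ} (h0 : 0 < l) (h1 : l < 1) :
    volume X ^ l * volume Y ^ (1 - l) ≤ volume (l • X + (1 - l) • Y) := by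
  have h1' : 0 < 1 - l := sub_pos.2 h1
  have hZ : MeasurableSet (l • X + (1 - l) • Y) := ((hX.smul l).add (hY.smul (1 - l))).measurableSet
  have := pl_euc n l h0 h1 (X.indicator 1) (Y.indicator 1) ((l • X + (1 - l) • Y).indicator 1)
    (measurable_one.indicator hX.measurableSet) (measurable_one.indicator hY.measurableSet)
    (measurable_one.indicator hZ) ?_
  · rwa [lintegral_indicator_one hX.measurableSet, lintegral_indicator_one hY.measurableSet,
      lintegral_indicator_one hZ] at this
  · intro x y
    by_cases hx : x ∈ X
    · by_cases hy : y ∈ Y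
      · have : l • x + (1 - l) • y ∈ l • X + (1 - l) • Y :=
          Set.add_mem_add (Set.smul_mem_smul_set hx) (Set.smul_mem_smul_set hy)
        rw [Set.indicator_of_mem hx, Set.indicator_of_mem hy, Set.indicator_of_mem this]
        simp
      · rw [Set.indicator_of_notMem hy]; simp [h1']
    · rw [Set.indicator_of_notMem hx]; simp [h0]

lemma vol_smul {n : ℕ} (X : Set (EuclideanSpace ℝ (Fin n))) {t : ℝ} (ht : 0 ≤ t) :
    (volume (t • X)).toReal = t ^ n * (volume X).toReal := by
  rw [Measure.addHaar_smul]
  simp only [finrank_euclideanSpace, Fintype.card_fin, ENNReal.toReal_mul, abs_of_nonneg (pow_nonneg ht n),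
    ENNReal.toReal_ofReal (pow_nonneg ht n)]

lemma bm_add {n : ℕ} (hn : 1 ≤ n) {X Y : Set (EuclideanSpace ℝ (Fin n))} (hX : IsCompact X)
    (hY : IsCompact Y) (hX0 : 0 < (volume X).toReal) (hY0 : 0 < (volume Y).toReal) :
    (volume X).toReal ^ (1 / (n : ℝ)) + (volume Y).toReal ^ (1 / (n : ℝ))
      ≤ (volume (X + Y)).toReal ^ (1 / (n : ℝ)) := by
  have hn0 : (n : ℝ) ≠ 0 := by positivity
  set a := (volume X).toReal ^ (1 / (n : ℝ)) with ha
  set b := (volume Y).toReal ^ (1 / (n : ℝ)) with hb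
  have ha0 : 0 < a := by positivity
  have hb0 : 0 < b := by positivity
  have han : a ^ n = (volume X).toReal := by
    rw [ha, ← Real.rpow_natCast, ← Real.rpow_mul hX0.le, one_div_mul_cancel hn0, Real.rpow_one]
  have hbn : b ^ n = (volume Y).toReal := by
    rw [hb, ← Real.rpow_natCast, ← Real.rpow_mul hY0.le, one_div_mul_cancel hn0, Real.rpow_one]
  have h := bm_mult (hX.smul a⁻¹) (hY.smul b⁻¹) (l := a / (a + b)) (by positivity)
    (by rw [div_lt_one (by positivity)]; linarith)
  have e1 : volume (a⁻¹ • X) = 1 := by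
    rw [← ENNReal.toReal_eq_one_iff, vol_smul _ (by positivity), inv_pow, han, inv_mul_cancel₀ hX0.ne']
  have e2 : volume (b⁻¹ • Y) = 1 := by
    rw [← ENNReal.toReal_eq_one_iff, vol_smul _ (by positivity), inv_pow, hbn, inv_mul_cancel₀ hY0.ne']
  have e3 : (a / (a + b)) • a⁻¹ • X + (1 - a / (a + b)) • b⁻¹ • Y = (a + b)⁻¹ • (X + Y) := by
    have e4 : 1 - a / (a + b) = b / (a + b) := by field_simp; ring
    rw [e4, smul_smul, smul_smul, smul_add]
    congr 2 <;> field_simp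
  rw [e1, e2, e3] at h
  have hfin : volume ((a + b)⁻¹ • (X + Y)) ≠ ⊤ := ((hX.add hY).smul _).measure_lt_top.ne
  have h' := ENNReal.toReal_mono hfin h
  rw [vol_smul _ (by positivity)] at h'
  simp only [ENNReal.one_rpow, mul_one, ENNReal.toReal_one, inv_pow] at h'
  have h2 : (a + b) ^ n ≤ (volume (X + Y)).toReal := by
    rw [inv_mul_eq_div, le_div_iff₀ (by positivity)] at h'
    linarith
  calc a + b = ((a + b) ^ n) ^ (1 / (n : ℝ)) := by
        rw [← Real.rpow_natCast, ← Real.rpow_mul (by positivity), mul_one_div_cancel hn0, Real.rpow_one]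
    _ ≤ _ := by gcongr

lemma body_pos {n : ℕ} {K : Set (EuclideanSpace ℝ (Fin n))} (hK : IsConvexBody K) :
    0 < (volume K).toReal :=
  ENNReal.toReal_pos ((Measure.measure_pos_of_nonempty_interior _ hK.2.2).ne') hK.2.1.measure_lt_top.ne

lemma body_add {n : ℕ} {A K : Set (EuclideanSpace ℝ (Fin n))} (hA : IsConvexBody A)
    (hK : Convex ℝ K) (hK' : IsCompact K) (hK0 : K.Nonempty) : IsConvexBody (A + K) := by
  refine ⟨hA.1.add hK, hA.2.1.add hK', ?_⟩
  obtain ⟨x, hx⟩ := hA.2.2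
  obtain ⟨y, hy⟩ := hK0
  refine ⟨x + y, ?_⟩
  exact subset_interior_add_left (Set.add_mem_add hx hy)

lemma body_smul {n : ℕ} {A : Set (EuclideanSpace ℝ (Fin n))} (hA : IsConvexBody A) {t : ℝ}
    (ht : 0 < t) : IsConvexBody (t • A) := by
  refine ⟨hA.1.smul t, hA.2.1.smul t, ?_⟩
  rw [interior_smul₀ ht.ne']
  exact hA.2.2.smul_set

/-- Concavity of the `n`-th root of the volume of `A + t K`. -/
lemma vol_concave {n : ℕ} (hn : 1 ≤ n) {A K : Set (EuclideanSpace ℝ (Fin n))}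
    (hA : IsConvexBody A) (hK : Convex ℝ K) (hK' : IsCompact K) (hK0 : K.Nonempty) :
    ConcaveOn ℝ (Set.Ici 0) (fun t : ℝ => (volume (A + t • K)).toReal ^ (1 / (n : ℝ))) := by
  have hn0 : (n : ℝ) ≠ 0 := by positivity
  refine ⟨convex_Ici 0, ?_⟩
  intro s hs t ht a b ha hb hab
  rcases ha.eq_or_lt with rfl | ha
  · have : b = 1 := by linarith
    subst this; simp
  rcases hb.eq_or_lt with rfl | hb
  · have : a = 1 := by linarith
    subst this; simp
  have hs' : (0 : ℝ) ≤ s := hs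
  have ht' : (0 : ℝ) ≤ t := ht
  have bs : IsConvexBody (A + s • K) := body_add hA (hK.smul s) (hK'.smul s) hK0.smul_set
  have bt : IsConvexBody (A + t • K) := body_add hA (hK.smul t) (hK'.smul t) hK0.smul_set
  have h := bm_add hn (body_smul bs ha).2.1 (body_smul bt hb).2.1 (body_pos (body_smul bs ha))
    (body_pos (body_smul bt hb))
  have e : a • (A + s • K) + b • (A + t • K) = A + (a • s + b • t) • K := by
    rw [smul_add, smul_add, smul_smul, smul_smul, add_add_add_comm, ← hA.1.add_smul ha.le hb.le,
      ← hK.add_smul (by positivity) (by positivity), hab, one_smul]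
    rfl
  rw [e, vol_smul _ ha.le, vol_smul _ hb.le, Real.mul_rpow (by positivity) (by positivity),
    Real.mul_rpow (by positivity) (by positivity), ← Real.rpow_natCast, ← Real.rpow_mul ha.le,
    ← Real.rpow_natCast, ← Real.rpow_mul hb.le, mul_one_div_cancel hn0, Real.rpow_one,
    Real.rpow_one] at h
  simpa using h

end IterFen

namespace IterFen
open scoped RealInnerProductSpace

lemma hasFDerivAt_G {n : ℕ} {F : Type} [NormedAddCommGroup F] [NormedSpace ℝ F]
    {K : Set (EuclideanSpace ℝ (Fin n))} (hK : IsCompact K) {w : EuclideanSpace ℝ (Fin n) → F}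
    (hw : Continuous w) (x : EuclideanSpace ℝ (Fin n)) :
    HasFDerivAt (fun x => ∫ y in K, Real.exp ⟪x, y⟫ • w y)
      (∫ y in K, Real.exp ⟪x, y⟫ • (innerSL ℝ y).smulRight (w y)) x := by
  have hc : Continuous fun p : EuclideanSpace ℝ (Fin n) × EuclideanSpace ℝ (Fin n) =>
      Real.exp ⟪p.1, p.2⟫ • (innerSL ℝ p.2).smulRight (w p.2) := by
    have : Continuous fun y : EuclideanSpace ℝ (Fin n) => (innerSL ℝ y).smulRight (w y) := by
      have h2 : Continuous fun y : EuclideanSpace ℝ (Fin n) =>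
        ContinuousLinearMap.smulRightL ℝ (EuclideanSpace ℝ (Fin n)) F (innerSL ℝ y) (w y) := by
        fun_prop
      exact h2
    fun_prop
  obtain ⟨C, hC⟩ := ((isCompact_closedBall x 1).prod hK).exists_bound_of_continuousOn hc.continuousOn
  have hfin : IsFiniteMeasure (volume.restrict K) := ⟨by simpa using hK.measure_lt_top⟩
  refine hasFDerivAt_integral_of_dominated_of_fderiv_le (μ := volume.restrict K)
    (F := fun x y => Real.exp ⟪x, y⟫ • w y)
    (F' := fun x y => Real.exp ⟪x, y⟫ • (innerSL ℝ y).smulRight (w y))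
    (bound := fun _ => C) (Metric.ball_mem_nhds x one_pos) ?_ ?_ ?_ ?_ (integrable_const _) ?_
  · refine Filter.Eventually.of_forall fun x' => ?_
    exact Continuous.aestronglyMeasurable (by fun_prop)
  · exact (Continuous.continuousOn (by fun_prop)).integrableOn_compact hK
  · exact Continuous.aestronglyMeasurable (hc.comp (by fun_prop : Continuous fun y => (x, y)))
  · refine (ae_restrict_mem hK.measurableSet).mono fun y hy x' hx' => ?_
    exact hC (x', y) ⟨Metric.ball_subset_closedBall hx', hy⟩
  · refine Filter.Eventually.of_forall fun y x' hx' => ?_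
    have h1 : HasFDerivAt (fun x : EuclideanSpace ℝ (Fin n) => ⟪x, y⟫) (innerSL ℝ y) x' := by
      have := (innerSL ℝ y).hasFDerivAt (x := x')
      refine this.congr_of_eventuallyEq (Filter.Eventually.of_forall fun z => ?_)
      simp [real_inner_comm]
    have h2 := (h1.exp).smul_const (w y)
    convert h2 using 1
    ext u
    simp [smul_smul]

lemma int_on {n : ℕ} {F : Type} [NormedAddCommGroup F]
    {K : Set (EuclideanSpace ℝ (Fin n))} (hK : IsCompact K) {w : EuclideanSpace ℝ (Fin n) → F}
    (hw : Continuous w) : IntegrableOn w K := hw.continuousOn.integrableOn_compact hK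

/-- The partition function of `K`. -/
noncomputable def Zf {n : ℕ} (K : Set (EuclideanSpace ℝ (Fin n))) (x : EuclideanSpace ℝ (Fin n)) : ℝ :=
  ∫ y in K, Real.exp ⟪x, y⟫

/-- Gromov's map. -/
noncomputable def Tm {n : ℕ} (K : Set (EuclideanSpace ℝ (Fin n))) (x : EuclideanSpace ℝ (Fin n)) :
    EuclideanSpace ℝ (Fin n) :=
  (Zf K x)⁻¹ • ∫ y in K, Real.exp ⟪x, y⟫ • y

/-- The derivative of Gromov's map. -/
noncomputable def Hm {n : ℕ} (K : Set (EuclideanSpace ℝ (Fin n))) (x : EuclideanSpace ℝ (Fin n)) :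
    EuclideanSpace ℝ (Fin n) →L[ℝ] EuclideanSpace ℝ (Fin n) :=
  (Zf K x)⁻¹ • ∫ y in K, Real.exp ⟪x, y⟫ • (innerSL ℝ y).smulRight (y - Tm K x)

variable {n : ℕ} {K : Set (EuclideanSpace ℝ (Fin n))}

lemma Zf_pos (hK : IsConvexBody K) (x : EuclideanSpace ℝ (Fin n)) : 0 < Zf K x := by
  have : NeZero (volume.restrict K) :=
    ⟨by
      rw [Ne, Measure.restrict_eq_zero]
      exact (Measure.measure_pos_of_nonempty_interior _ hK.2.2).ne'⟩
  exact integral_exp_pos (int_on hK.2.1 (by fun_prop : Continuous fun y => Real.exp ⟪x, y⟫))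

lemma Tm_mem (hK : IsConvexBody K) (x : EuclideanSpace ℝ (Fin n)) : Tm K x ∈ K := by
  have : NeZero (volume.restrict K) :=
    ⟨by
      rw [Ne, Measure.restrict_eq_zero]
      exact (Measure.measure_pos_of_nonempty_interior _ hK.2.2).ne'⟩
  have hi := int_on hK.2.1 (by fun_prop : Continuous fun y => Real.exp ⟪x, y⟫)
  have hp := isProbabilityMeasure_tilted (μ := volume.restrict K) (f := fun y => ⟪x, y⟫) hi
  have e : Tm K x = ∫ y, y ∂((volume.restrict K).tilted fun y => ⟪x, y⟫) := by
    rw [integral_tilted]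
    simp only [Tm, div_eq_inv_mul, ← smul_smul, Zf]
    rw [integral_smul]
  rw [e]
  refine hK.1.integral_mem hK.2.1.isClosed ?_ ?_
  · exact (tilted_absolutelyContinuous _ _).ae_le (ae_restrict_mem hK.2.1.measurableSet)
  · rw [integrable_tilted_iff hi]
    exact int_on hK.2.1 (by fun_prop : Continuous fun y => Real.exp ⟪x, y⟫ • y)

lemma int_center (hK : IsConvexBody K) (x : EuclideanSpace ℝ (Fin n)) :
    ∫ y in K, Real.exp ⟪x, y⟫ • (y - Tm K x) = 0 := by
  simp only [smul_sub]
  rw [integral_sub (int_on hK.2.1 (by fun_prop)) (int_on hK.2.1 (by fun_prop)), integral_smul_const]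
  change _ - Zf K x • _ = 0
  rw [Tm, smul_smul, mul_inv_cancel₀ (Zf_pos hK x).ne', one_smul, sub_self]

lemma hasFDerivAt_Zf (hK : IsConvexBody K) (x : EuclideanSpace ℝ (Fin n)) :
    HasFDerivAt (Zf K) (Zf K x • innerSL ℝ (Tm K x)) x := by
  have := hasFDerivAt_G hK.2.1 (w := fun _ => (1 : ℝ)) continuous_const x
  simp only [smul_eq_mul, mul_one] at this
  refine this.congr_fderiv ?_
  ext u
  rw [ContinuousLinearMap.integral_apply]
  · simp only [Tm, smul_smul, map_smul, mul_inv_cancel₀ (Zf_pos hK x).ne', one_smul]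
    rw [innerSL_apply_apply, real_inner_comm, ← innerSL_apply_apply ℝ, ← ContinuousLinearMap.integral_comp_comm]
    · simp [real_inner_comm]
    · exact int_on hK.2.1 (by fun_prop)
  · apply int_on hK.2.1
    have h2 : Continuous fun y : EuclideanSpace ℝ (Fin n) =>
        ContinuousLinearMap.smulRightL ℝ (EuclideanSpace ℝ (Fin n)) ℝ (innerSL ℝ y) 1 := by
        fun_prop
    exact (by fun_prop : Continuous fun y => Real.exp ⟪x, y⟫).smul h2

lemma hasFDerivAt_Tm (hK : IsConvexBody K) (x : EuclideanSpace ℝ (Fin n)) :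
    HasFDerivAt (Tm K) (Hm K x) x := by
  have hG := hasFDerivAt_G hK.2.1 (w := fun y => y - Tm K x) (by fun_prop) x
  have hZ := (hasFDerivAt_Zf hK x)
  have hZ' : DifferentiableAt ℝ (fun x => (Zf K x)⁻¹) x :=
    hZ.differentiableAt.inv (Zf_pos hK x).ne'
  have h := (hZ'.hasFDerivAt.smul hG).const_add (Tm K x)
  have e : Tm K = fun x' => Tm K x + (Zf K x')⁻¹ • ∫ y in K, Real.exp ⟪x', y⟫ • (y - Tm K x) := by
    funext x'
    simp only [smul_sub]
    rw [integral_sub (int_on hK.2.1 (by fun_prop)) (int_on hK.2.1 (by fun_prop)), integral_smul_const]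
    change _ = _ + _ • (_ - Zf K x' • _)
    rw [smul_sub, smul_smul, inv_mul_cancel₀ (Zf_pos hK x').ne', one_smul]
    simp [Tm]
  rw [e]
  refine h.congr_fderiv ?_
  rw [int_center hK x]
  ext u
  simp [Hm]

lemma Hm_inner (hK : IsConvexBody K) (x u w : EuclideanSpace ℝ (Fin n)) :
    ⟪w, Hm K x u⟫ = (Zf K x)⁻¹ *
      ∫ y in K, Real.exp ⟪x, y⟫ * (⟪y - Tm K x, u⟫ * ⟪y - Tm K x, w⟫) := by
  have hc : Continuous fun y : EuclideanSpace ℝ (Fin n) =>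
      Real.exp ⟪x, y⟫ • (innerSL ℝ y).smulRight (y - Tm K x) := by
    have h2 : Continuous fun y : EuclideanSpace ℝ (Fin n) =>
        ContinuousLinearMap.smulRightL ℝ (EuclideanSpace ℝ (Fin n)) _ (innerSL ℝ y) (y - Tm K x) := by
        fun_prop
    exact (by fun_prop : Continuous fun y => Real.exp ⟪x, y⟫).smul h2
  have h0 : ∫ y in K, Real.exp ⟪x, y⟫ * ⟪w, y - Tm K x⟫ = 0 := by
    have := congrArg (innerSL ℝ w) (int_center hK x)
    rw [← ContinuousLinearMap.integral_comp_comm _ (int_on hK.2.1 (by fun_prop))] at this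
    simpa [inner_smul_right] using this
  rw [Hm, ContinuousLinearMap.smul_apply, inner_smul_right,
    ContinuousLinearMap.integral_apply (int_on hK.2.1 hc), ← innerSL_apply_apply ℝ,
    ← ContinuousLinearMap.integral_comp_comm]
  · congr 1
    have : ∀ y, Real.exp ⟪x, y⟫ * (⟪y - Tm K x, u⟫ * ⟪y - Tm K x, w⟫) =
      Real.exp ⟪x, y⟫ * (⟪y, u⟫ * ⟪y - Tm K x, w⟫) - ⟪Tm K x, u⟫ * (Real.exp ⟪x, y⟫ * ⟪w, y - Tm K x⟫) := by
      intro y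
      rw [inner_sub_left, real_inner_comm w (y - Tm K x)]
      ring
    simp only [this]
    rw [integral_sub (int_on hK.2.1 (by fun_prop)) (int_on hK.2.1 (by fun_prop)),
      integral_const_mul, h0, mul_zero, sub_zero]
    congr 1
    funext y
    simp [inner_smul_right, real_inner_comm w]
  · exact int_on hK.2.1 (hc.clm_apply continuous_const)

lemma Hm_symm (hK : IsConvexBody K) (x u w : EuclideanSpace ℝ (Fin n)) :
    ⟪w, Hm K x u⟫ = ⟪u, Hm K x w⟫ := by
  rw [Hm_inner hK, Hm_inner hK]
  simp only [mul_comm ⟪_, u⟫]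

lemma Hm_nonneg (hK : IsConvexBody K) (x u : EuclideanSpace ℝ (Fin n)) :
    0 ≤ ⟪u, Hm K x u⟫ := by
  rw [Hm_inner hK]
  refine mul_nonneg (inv_nonneg.2 (Zf_pos hK x).le) (integral_nonneg fun y => ?_)
  have := mul_self_nonneg ⟪y - Tm K x, u⟫
  positivity

lemma Hm_pos (hK : IsConvexBody K) (x u : EuclideanSpace ℝ (Fin n)) (hu : u ≠ 0) :
    0 < ⟪u, Hm K x u⟫ := by
  refine (Hm_nonneg hK x u).lt_of_ne' fun h => ?_
  rw [Hm_inner hK] at h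
  have h := (mul_eq_zero.1 h).resolve_left (inv_ne_zero (Zf_pos hK x).ne')
  have hc : Continuous fun y : EuclideanSpace ℝ (Fin n) =>
      Real.exp ⟪x, y⟫ * (⟪y - Tm K x, u⟫ * ⟪y - Tm K x, u⟫) := by fun_prop
  rw [integral_eq_zero_iff_of_nonneg (fun y => by
    have := mul_self_nonneg ⟪y - Tm K x, u⟫
    positivity) (int_on hK.2.1 hc)] at h
  have h' := ae_restrict_of_ae_restrict_of_subset interior_subset h
  have h2 := Measure.eqOn_open_of_ae_eq h' isOpen_interior hc.continuousOn continuousOn_const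
  have h3 : ∀ y ∈ interior K, ⟪y - Tm K x, u⟫ = 0 := by
    intro y hy
    have := h2 hy
    simpa [Real.exp_ne_zero] using this
  obtain ⟨q, hq⟩ := hK.2.2
  have hcont : Continuous fun s : ℝ => q + s • u := by fun_prop
  have hev : ∀ᶠ s : ℝ in nhds 0, q + s • u ∈ interior K :=
    hcont.continuousAt.eventually (isOpen_interior.mem_nhds (by simpa using hq))
  obtain ⟨s, hs, hs0⟩ := ((hev.filter_mono nhdsWithin_le_nhds).and
    (self_mem_nhdsWithin (s := Set.Ioi (0 : ℝ)))).exists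
  have e1 := h3 q hq
  have e2 := h3 _ hs
  rw [add_sub_right_comm, inner_add_left, e1, zero_add, inner_smul_left] at e2
  rcases mul_eq_zero.1 e2 with e | e
  · exact (ne_of_gt hs0) (by simpa using e)
  · exact hu (inner_self_eq_zero.1 e)

end IterFen

namespace IterFen
open scoped RealInnerProductSpace

lemma Zf_lower {n : ℕ} {K : Set (EuclideanSpace ℝ (Fin n))} (hK : IsConvexBody K) {ε : ℝ}
    (h0 : 0 < ε) (h1 : ε < 1) (x k : EuclideanSpace ℝ (Fin n)) (hk : k ∈ K) :
    ⟪x, k⟫ - ε * Metric.diam K * ‖x‖ + Real.log (ε ^ n * (volume K).toReal) ≤ Real.log (Zf K x) := by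
  have hv : 0 < ε ^ n * (volume K).toReal := mul_pos (pow_pos h0 n) (body_pos hK)
  have hexp : Real.exp (⟪x, k⟫ - ε * Metric.diam K * ‖x‖) * (ε ^ n * (volume K).toReal) ≤ Zf K x := by
    set S := ((1 - ε) • k) +ᵥ (ε • K) with hS
    have hSK : S ⊆ K := by
      rintro _ ⟨_, ⟨y, hy, rfl⟩, rfl⟩
      exact hK.1 hk hy (by linarith) h0.le (by ring)
    have hSm : MeasurableSet S := ((hK.2.1.smul ε).vadd _).measurableSet
    have hvS : volume.real S = ε ^ n * (volume K).toReal := by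
      rw [Measure.real, hS, measure_vadd, vol_smul _ h0.le]
    have hi := int_on hK.2.1 (by fun_prop : Continuous fun y => Real.exp ⟪x, y⟫)
    calc _ = ∫ y in S, Real.exp (⟪x, k⟫ - ε * Metric.diam K * ‖x‖) := by
          rw [setIntegral_const, hvS, smul_eq_mul, mul_comm]
      _ ≤ ∫ y in S, Real.exp ⟪x, y⟫ := by
          refine setIntegral_mono_on ?_ (hi.mono_set hSK) hSm ?_
          · exact integrableOn_const ((measure_mono hSK).trans_lt hK.2.1.measure_lt_top).ne
          · rintro _ ⟨_, ⟨y, hy, rfl⟩, rfl⟩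
            apply Real.exp_le_exp.2
            simp only [vadd_eq_add]
            have e : (1 - ε) • k + ε • y = k + ε • (y - k) := by module
            rw [e, inner_add_right, inner_smul_right]
            have h2 : |⟪x, y - k⟫| ≤ ‖x‖ * ‖y - k‖ := abs_real_inner_le_norm _ _
            have h3 : ‖y - k‖ ≤ Metric.diam K := by
              rw [← dist_eq_norm]
              exact Metric.dist_le_diam_of_mem hK.2.1.isBounded hy hk
            have h4 := (abs_le.1 h2).1
            have h5 : ‖x‖ * ‖y - k‖ ≤ ‖x‖ * Metric.diam K := by gcongr
            have h6 : ε * (-(‖x‖ * Metric.diam K)) ≤ ε * ⟪x, y - k⟫ := by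
              gcongr; linarith
            linarith
      _ ≤ Zf K x := setIntegral_mono_set hi
          (Filter.Eventually.of_forall fun y => (Real.exp_pos _).le) hSK.eventuallyLE
  have := Real.log_le_log (by positivity) hexp
  rwa [Real.log_mul (Real.exp_pos _).ne' hv.ne', Real.log_exp] at this

variable {n : ℕ} {ι : Type} [Fintype ι] {K : ι → Set (EuclideanSpace ℝ (Fin n))} {c : ι → ℝ}

lemma Tsum_inj (hK : ∀ i, IsConvexBody (K i)) (hc : ∀ i, 0 ≤ c i) (hc' : ∃ i, 0 < c i) :
    Function.Injective (fun x => ∑ i, c i • Tm (K i) x) := by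
  intro x x' h
  by_contra hne
  set u := x' - x with hu
  have hu0 : u ≠ 0 := sub_ne_zero.2 (Ne.symm hne)
  have hd : ∀ s : ℝ, HasDerivAt (fun s : ℝ => ⟪u, ∑ i, c i • Tm (K i) (x + s • u)⟫)
      (∑ i, c i * ⟪u, Hm (K i) (x + s • u) u⟫) s := by
    intro s
    have h1 : HasDerivAt (fun s : ℝ => x + s • u) u s := by
      simpa using ((hasDerivAt_id s).smul_const u).const_add x
    have h2 : HasDerivAt (fun s : ℝ => ∑ i, c i • Tm (K i) (x + s • u))
        (∑ i, c i • Hm (K i) (x + s • u) u) s := by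
      apply HasDerivAt.fun_sum
      intro i _
      exact ((hasFDerivAt_Tm (hK i) (x + s • u)).comp_hasDerivAt s h1).const_smul (c i)
    have h3 := ((innerSL ℝ u).hasFDerivAt).comp_hasDerivAt s h2
    simpa [Function.comp_def, inner_sum, inner_smul_right] using h3
  have hm : StrictMono (fun s : ℝ => ⟪u, ∑ i, c i • Tm (K i) (x + s • u)⟫) := by
    apply strictMono_of_deriv_pos
    intro s
    rw [(hd s).deriv]
    obtain ⟨i, hi⟩ := hc'
    exact Finset.sum_pos' (fun j _ => mul_nonneg (hc j) (Hm_nonneg (hK j) _ u))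
      ⟨i, Finset.mem_univ _, mul_pos hi (Hm_pos (hK i) _ u hu0)⟩
  have h01 := hm (zero_lt_one (α := ℝ))
  simp only [zero_smul, add_zero, one_smul, hu, add_sub_cancel] at h01
  simp only at h
  rw [h] at h01
  exact lt_irrefl _ h01

lemma Tsum_surj (hK : ∀ i, IsConvexBody (K i)) (hc : ∀ i, 0 ≤ c i)
    (p : EuclideanSpace ℝ (Fin n)) (hp : p ∈ interior (∑ i, c i • K i)) :
    ∃ x, ∑ i, c i • Tm (K i) x = p := by
  obtain ⟨r, hr, hball⟩ := Metric.isOpen_iff.1 isOpen_interior p hp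
  set f : EuclideanSpace ℝ (Fin n) → ℝ := fun x => ∑ i, c i * Real.log (Zf (K i) x) - ⟪p, x⟫ with hf
  have hd : ∀ x, HasFDerivAt f (innerSL ℝ (∑ i, c i • Tm (K i) x - p)) x := by
    intro x
    have h1 : ∀ i ∈ Finset.univ, HasFDerivAt (fun x => c i * Real.log (Zf (K i) x))
        (c i • innerSL ℝ (Tm (K i) x)) x := by
      intro i _
      have := ((hasFDerivAt_Zf (hK i) x).log (Zf_pos (hK i) x).ne').const_mul (c i)
      rwa [smul_smul (Zf (K i) x)⁻¹, inv_mul_cancel₀ (Zf_pos (hK i) x).ne', one_smul] at this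
    have h2 := (HasFDerivAt.fun_sum h1).sub ((innerSL ℝ p).hasFDerivAt (x := x))
    have h3 := h2.congr_fderiv (g' := innerSL ℝ (∑ i, c i • Tm (K i) x - p))
      (by simp [map_sub, map_sum, map_smul])
    exact h3
  have hfc : Continuous f := continuous_iff_continuousAt.2 fun x => (hd x).continuousAt
  -- coercivity
  set D := ∑ i, c i * Metric.diam (K i) with hD
  have hD0 : 0 ≤ D := Finset.sum_nonneg fun i _ => mul_nonneg (hc i) Metric.diam_nonneg
  obtain ⟨ε, he0, he1, heD⟩ : ∃ ε : ℝ, 0 < ε ∧ ε < 1 ∧ ε * D ≤ r / 4 := by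
    refine ⟨min (1 / 2) (r / 4 / (D + 1)), by positivity, by
      exact (min_le_left _ _).trans_lt (by norm_num), ?_⟩
    calc _ ≤ r / 4 / (D + 1) * D := by gcongr; exact min_le_right _ _
      _ ≤ r / 4 / (D + 1) * (D + 1) := by gcongr; linarith
      _ = r / 4 := by field_simp
  set C := ∑ i, c i * Real.log (ε ^ n * (volume (K i)).toReal) with hC
  have hlow : ∀ x, r / 4 * ‖x‖ + C ≤ f x := by
    intro x
    obtain ⟨z, hz, hzx⟩ : ∃ z ∈ ∑ i, c i • K i, ⟪x, z⟫ = ⟪p, x⟫ + r / 2 * ‖x‖ := by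
      refine ⟨p + (r / 2 * ‖x‖⁻¹) • x, interior_subset (hball ?_), ?_⟩
      · rw [mem_ball_iff_norm, add_sub_cancel_left, norm_smul]
        rcases eq_or_ne x 0 with rfl | hx
        · simpa using hr
        · have : 0 < ‖x‖ := norm_pos_iff.2 hx
          rw [Real.norm_of_nonneg (by positivity)]
          field_simp
          linarith
      · rw [inner_add_right, inner_smul_right, real_inner_self_eq_norm_sq, real_inner_comm]
        rcases eq_or_ne x 0 with rfl | hx
        · simp
        · have : 0 < ‖x‖ := norm_pos_iff.2 hx
          field_simp
    rw [Set.mem_finsetSum] at hz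
    obtain ⟨g, hg, hgz⟩ := hz
    have hg' : ∀ i, ∃ k ∈ K i, c i • k = g i := fun i => hg (Finset.mem_univ i)
    choose k hk hkg using hg'
    have h1 : ∀ i, c i * (⟪x, k i⟫ - ε * Metric.diam (K i) * ‖x‖
        + Real.log (ε ^ n * (volume (K i)).toReal)) ≤ c i * Real.log (Zf (K i) x) :=
      fun i => mul_le_mul_of_nonneg_left (Zf_lower (hK i) he0 he1 x (k i) (hk i)) (hc i)
    have h2 := Finset.sum_le_sum fun i (_ : i ∈ Finset.univ) => h1 i
    have h3 : ∑ i, c i * (⟪x, k i⟫ - ε * Metric.diam (K i) * ‖x‖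
        + Real.log (ε ^ n * (volume (K i)).toReal)) = ⟪x, z⟫ - ε * D * ‖x‖ + C := by
      rw [← hgz, hD, hC, inner_sum, Finset.mul_sum, Finset.sum_mul, ← Finset.sum_sub_distrib,
        ← Finset.sum_add_distrib]
      refine Finset.sum_congr rfl fun i _ => ?_
      rw [← hkg, inner_smul_right]
      ring
    have h4 : ε * D * ‖x‖ ≤ r / 4 * ‖x‖ := by gcongr
    simp only [hf]
    linarith
  have hlim : Filter.Tendsto f (Filter.cocompact _) Filter.atTop := by
    refine Filter.tendsto_atTop_mono hlow ?_
    exact Filter.tendsto_atTop_add_const_right _ _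
      ((tendsto_norm_cocompact_atTop).const_mul_atTop (by positivity))
  obtain ⟨x, hx⟩ := hfc.exists_forall_le hlim
  have hmin : IsLocalMin f x := Filter.Eventually.of_forall hx
  have h0 := hmin.hasFDerivAt_eq_zero (hd x)
  refine ⟨x, ?_⟩
  have h1 := congrArg (fun L => L (∑ i, c i • Tm (K i) x - p)) h0
  simp only [innerSL_apply_apply, ContinuousLinearMap.zero_apply, inner_self_eq_zero] at h1
  exact sub_eq_zero.1 h1

lemma sum_convex (hK : ∀ i, IsConvexBody (K i)) (s : Finset ι) : Convex ℝ (∑ i ∈ s, c i • K i) := by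
  classical
  induction s using Finset.induction_on with
  | empty => rw [Finset.sum_empty]; exact convex_singleton (𝕜 := ℝ) (0 : EuclideanSpace ℝ (Fin n))
  | insert a s ha ih => rw [Finset.sum_insert ha]; exact ((hK a).1.smul _).add ih

lemma sum_compact (hK : ∀ i, IsConvexBody (K i)) (s : Finset ι) : IsCompact (∑ i ∈ s, c i • K i) := by
  classical
  induction s using Finset.induction_on with
  | empty => rw [Finset.sum_empty]; exact isCompact_singleton (x := (0 : EuclideanSpace ℝ (Fin n)))
  | insert a s ha ih => rw [Finset.sum_insert ha]; exact ((hK a).2.1.smul _).add ih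

lemma Hm_meas (hK : ∀ i, IsConvexBody (K i)) (i : ι) : Measurable (Hm (K i)) := by
  have : Hm (K i) = fderiv ℝ (Tm (K i)) := funext fun x => (hasFDerivAt_Tm (hK i) x).fderiv.symm
  rw [this]
  exact measurable_fderiv _ _

lemma gromov_lintegral (hK : ∀ i, IsConvexBody (K i)) (hc : ∀ i, 0 ≤ c i) (hc' : ∃ i, 0 < c i) :
    ∫⁻ x, ENNReal.ofReal |(∑ i, c i • Hm (K i) x).det| = volume (∑ i, c i • K i) := by
  have h := lintegral_abs_det_fderiv_eq_addHaar_image (volume : Measure (EuclideanSpace ℝ (Fin n)))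
    (s := Set.univ) (f := fun x => ∑ i, c i • Tm (K i) x) (f' := fun x => ∑ i, c i • Hm (K i) x)
    MeasurableSet.univ (fun x _ => by
      apply HasFDerivAt.hasFDerivWithinAt
      apply HasFDerivAt.fun_sum
      intro i _
      exact (hasFDerivAt_Tm (hK i) x).const_smul (c i)) (Tsum_inj hK hc hc').injOn
  rw [Measure.restrict_univ] at h
  rw [h]
  have h1 : (fun x => ∑ i, c i • Tm (K i) x) '' Set.univ ⊆ ∑ i, c i • K i := by
    rintro _ ⟨x, -, rfl⟩
    exact Set.finsetSum_mem_finsetSum _ _ _ fun i _ => Set.smul_mem_smul_set (Tm_mem (hK i) x)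
  have h2 : interior (∑ i, c i • K i) ⊆ (fun x => ∑ i, c i • Tm (K i) x) '' Set.univ := by
    intro p hp
    obtain ⟨x, hx⟩ := Tsum_surj hK hc p hp
    exact ⟨x, trivial, hx⟩
  have h3 : volume (interior (∑ i, c i • K i)) = volume (∑ i, c i • K i) :=
    measure_congr (interior_ae_eq_of_null_frontier
      ((sum_convex hK _).addHaar_frontier (volume : Measure (EuclideanSpace ℝ (Fin n)))))
  exact le_antisymm (measure_mono h1) (h3 ▸ measure_mono h2)

end IterFen

namespace IterFen
open Matrix

/-- Mixed row determinant. -/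
noncomputable def rd {n : ℕ} (M : Fin n → Matrix (Fin n) (Fin n) ℝ) : ℝ :=
  Matrix.det (Matrix.of fun a => M a a)

/-- Mixed discriminant (without the factorial). -/
noncomputable def md {n : ℕ} (M : Fin n → Matrix (Fin n) (Fin n) ℝ) : ℝ :=
  ∑ σ : Equiv.Perm (Fin n), rd (fun a => M (σ a))

lemma det_sum_expand {n : ℕ} {ι : Type} [Fintype ι] (c : ι → ℝ)
    (M : ι → Matrix (Fin n) (Fin n) ℝ) :
    Matrix.det (∑ i, c i • M i) = ∑ φ : Fin n → ι, (∏ j, c (φ j)) * rd (fun a => M (φ a)) := by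
  classical
  have h := (Matrix.detRowAlternating (n := Fin n) (R := ℝ)).toMultilinearMap.map_sum
    (fun (a : Fin n) (i : ι) => c i • M i a)
  have e : (fun a : Fin n => ∑ i, c i • M i a) = ∑ i, c i • M i := by
    funext a b
    simp [Finset.sum_apply, Matrix.sum_apply]
  rw [e] at h
  refine (Eq.trans ?_ h).trans ?_
  · rfl
  · refine Finset.sum_congr rfl fun φ _ => ?_
    have := (Matrix.detRowAlternating (n := Fin n) (R := ℝ)).toMultilinearMap.map_smul_univ
      (fun a => c (φ a)) (fun a => M (φ a) a)
    rw [this]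
    rfl

lemma det_sum_md {n : ℕ} {ι : Type} [Fintype ι] (c : ι → ℝ)
    (M : ι → Matrix (Fin n) (Fin n) ℝ) :
    Matrix.det (∑ i, c i • M i) =
      ∑ φ : Fin n → ι, (∏ j, c (φ j)) * ((n.factorial : ℝ)⁻¹ * md (fun a => M (φ a))) := by
  classical
  have h1 : ∀ σ : Equiv.Perm (Fin n), Matrix.det (∑ i, c i • M i) =
      ∑ φ : Fin n → ι, (∏ j, c (φ j)) * rd (fun a => M (φ (σ a))) := by
    intro σ
    rw [det_sum_expand]
    rw [← Equiv.sum_comp (σ.arrowCongr (Equiv.refl ι)).symm]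
    refine Finset.sum_congr rfl fun φ _ => ?_
    simp only [Equiv.arrowCongr_symm, Equiv.arrowCongr_apply, Equiv.symm_symm, Equiv.refl_symm,
      Function.comp_apply, Equiv.refl_apply]
    rw [Equiv.prod_comp σ (fun j => c (φ j))]
  have h2 : (n.factorial : ℝ) * Matrix.det (∑ i, c i • M i) =
      ∑ φ : Fin n → ι, (∏ j, c (φ j)) * md (fun a => M (φ a)) := by
    simp only [md, Finset.mul_sum]
    rw [Finset.sum_comm, ← Finset.sum_congr rfl fun σ _ => h1 σ]
    simp [Fintype.card_perm]
  have hn : (n.factorial : ℝ) ≠ 0 := by exact_mod_cast n.factorial_ne_zero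
  rw [← mul_right_inj' hn, h2, Finset.mul_sum]
  refine Finset.sum_congr rfl fun φ _ => ?_
  field_simp

lemma md_symm {n : ℕ} (M : Fin n → Matrix (Fin n) (Fin n) ℝ) (τ : Equiv.Perm (Fin n)) :
    md (fun a => M (τ a)) = md M := by
  unfold md
  rw [← Equiv.sum_comp (Equiv.mulLeft τ) (fun σ : Equiv.Perm (Fin n) => rd fun a => M (σ a))]
  rfl

lemma sign_sum {n : ℕ} (φ : Fin n → Fin n) :
    ∑ S : Finset (Fin n), (-1 : ℝ) ^ (n + S.card) * ∏ j, (if φ j ∈ S then (1 : ℝ) else 0) =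
      if Function.Bijective φ then 1 else 0 := by
  classical
  split_ifs with h
  · rw [Finset.sum_eq_single Finset.univ]
    · simp [← two_mul]
    · intro S _ hS
      obtain ⟨a, ha⟩ : ∃ a, a ∉ S := by
        by_contra hh; push Not at hh; exact hS (Finset.eq_univ_of_forall hh)
      obtain ⟨j, rfl⟩ := h.2 a
      rw [Finset.prod_eq_zero (Finset.mem_univ j) (by simp [ha]), mul_zero]
    · simp
  · have hs : ¬ Function.Surjective φ := fun hs => h ⟨Finite.injective_iff_surjective.2 hs, hs⟩
    have : ∃ a, ∀ j, φ j ≠ a := by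
      simpa [Function.Surjective] using hs
    obtain ⟨a, ha⟩ := this
    refine Finset.sum_involution (fun S _ => if a ∈ S then S.erase a else insert a S) ?_ ?_ ?_ ?_
    · intro S _
      have hp : ∀ S' : Finset (Fin n), (∀ j, φ j ∈ S' ↔ φ j ∈ S) →
          ∏ j, (if φ j ∈ S' then (1 : ℝ) else 0) = ∏ j, (if φ j ∈ S then (1 : ℝ) else 0) := by
        intro S' hS'
        simp only [hS']
      split_ifs with haS
      · rw [hp (S.erase a) (fun j => by simp [ha j]), ← Finset.card_erase_add_one haS]
        ring
      · rw [hp (insert a S) (fun j => by simp [ha j]), Finset.card_insert_of_notMem haS]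
        ring
    · intro S _ _ hS
      split_ifs at hS with haS
      · exact (Finset.erase_eq_self.1 hS) haS
      · exact haS (Finset.insert_eq_self.1 hS)
    · simp
    · intro S _
      by_cases haS : a ∈ S
      · simp [haS, Finset.insert_erase]
      · simp [haS]

lemma polar {n : ℕ} (M : Fin n → Matrix (Fin n) (Fin n) ℝ) :
    ∑ S : Finset (Fin n), (-1 : ℝ) ^ (n + S.card) *
      Matrix.det (∑ i, (if i ∈ S then (1 : ℝ) else 0) • M i) = md M := by
  classical
  simp only [det_sum_expand, Finset.mul_sum]
  rw [Finset.sum_comm]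
  simp only [← mul_assoc, ← Finset.sum_mul, sign_sum]
  simp only [ite_mul, one_mul, zero_mul]
  rw [← Finset.sum_filter, md]
  refine (Finset.sum_bij (fun (σ : Equiv.Perm (Fin n)) _ => (σ : Fin n → Fin n)) ?_ ?_ ?_ ?_).symm
  · intro σ _; exact Finset.mem_filter.2 ⟨Finset.mem_univ _, σ.bijective⟩
  · intro σ _ τ _ h; exact DFunLike.coe_injective h
  · intro φ hφ
    exact ⟨Equiv.ofBijective φ (Finset.mem_filter.1 hφ).2, Finset.mem_univ _, rfl⟩
  · intro σ _; rfl

open scoped MatrixOrder in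
lemma md_nonneg {n : ℕ} (M : Fin n → Matrix (Fin n) (Fin n) ℝ) (hM : ∀ i, (M i).PosSemidef) :
    0 ≤ md M := by
  classical
  have hB : ∀ i, ∃ B : Matrix (Fin n) (Fin n) ℝ, ∀ a b, M i a b = ∑ k, B k a * B k b := by
    intro i
    obtain ⟨B, hB⟩ := CStarAlgebra.nonneg_iff_eq_star_mul_self.mp (hM i).nonneg
    exact ⟨B, fun a b => by rw [hB]; simp [Matrix.mul_apply, Matrix.star_eq_conjTranspose]⟩
  choose B hB using hB
  have h1 : ∀ σ : Equiv.Perm (Fin n), rd (fun a => M (σ a)) =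
      ∑ κ : Fin n → Fin n, (∏ a, B (σ a) (κ (σ a)) a) *
        (Equiv.Perm.sign σ * Matrix.det (Matrix.of fun i => B i (κ i))) := by
    intro σ
    have h := (Matrix.detRowAlternating (n := Fin n) (R := ℝ)).toMultilinearMap.map_sum
      (fun (a : Fin n) (k : Fin n) => B (σ a) k a • B (σ a) k)
    have e : (fun a : Fin n => ∑ k, B (σ a) k a • B (σ a) k) = Matrix.of fun a => M (σ a) a := by
      funext a b
      simp [Finset.sum_apply, hB]
    rw [e] at h
    refine Eq.trans (Eq.trans ?_ h) ?_
    · rfl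
    rw [← Equiv.sum_comp (σ.arrowCongr (Equiv.refl (Fin n))).symm]
    refine Finset.sum_congr rfl fun κ _ => ?_
    have := (Matrix.detRowAlternating (n := Fin n) (R := ℝ)).toMultilinearMap.map_smul_univ
      (fun a => B (σ a) (κ (σ a)) a) (fun a => B (σ a) (κ (σ a)))
    refine this.trans ?_
    rw [smul_eq_mul]
    congr 1
    exact Matrix.det_permute σ (Matrix.of fun i => B i (κ i))
  have h2 : md M = ∑ κ : Fin n → Fin n, Matrix.det (Matrix.of fun i => B i (κ i)) ^ 2 := by
    unfold md
    simp only [h1]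
    rw [Finset.sum_comm]
    refine Finset.sum_congr rfl fun κ _ => ?_
    have hd := Matrix.det_apply' (Matrix.of fun i => B i (κ i))
    rw [sq]
    conv_rhs => lhs; rw [hd]
    rw [Finset.sum_mul]
    refine Finset.sum_congr rfl fun σ _ => ?_
    change _ = (Equiv.Perm.sign σ : ℝ) * (∏ a, B (σ a) (κ (σ a)) a) * _
    ring
  rw [h2]
  positivity

end IterFen

namespace IterFen
open scoped RealInnerProductSpace

/-- Matrix of the derivative of Gromov's map. -/
noncomputable def HM {n : ℕ} (K : Set (EuclideanSpace ℝ (Fin n))) (x : EuclideanSpace ℝ (Fin n)) :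
    Matrix (Fin n) (Fin n) ℝ :=
  LinearMap.toMatrix (EuclideanSpace.basisFun (Fin n) ℝ).toBasis
    (EuclideanSpace.basisFun (Fin n) ℝ).toBasis (Hm K x : _ →ₗ[ℝ] _)

variable {n : ℕ}

lemma HM_apply {K : Set (EuclideanSpace ℝ (Fin n))} (x : EuclideanSpace ℝ (Fin n)) (i j : Fin n) :
    HM K x i j = ⟪EuclideanSpace.single i (1 : ℝ), Hm K x (EuclideanSpace.single j (1 : ℝ))⟫ := by
  simp [HM, LinearMap.toMatrix_apply, EuclideanSpace.inner_single_left]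

lemma HM_posSemidef {K : Set (EuclideanSpace ℝ (Fin n))} (hK : IsConvexBody K)
    (x : EuclideanSpace ℝ (Fin n)) : (HM K x).PosSemidef := by
  refine Matrix.PosSemidef.of_dotProduct_mulVec_nonneg ?_ ?_
  · ext i j
    rw [Matrix.conjTranspose_apply, HM_apply, HM_apply, Hm_symm hK]
    simp
  · intro v
    have h := Hm_nonneg hK x (WithLp.toLp 2 v)
    have e : (HM K x).mulVec v = WithLp.ofLp (Hm K x (WithLp.toLp 2 v)) := by
      have := LinearMap.toMatrix_mulVec_repr (EuclideanSpace.basisFun (Fin n) ℝ).toBasis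
        (EuclideanSpace.basisFun (Fin n) ℝ).toBasis (Hm K x : _ →ₗ[ℝ] _) (WithLp.toLp 2 v)
      have hr : ∀ z : EuclideanSpace ℝ (Fin n),
          ⇑((EuclideanSpace.basisFun (Fin n) ℝ).toBasis.repr z) = z.ofLp := by
        intro z; ext i; simp
      rw [hr, hr] at this
      exact this
    rw [e]
    rw [PiLp.inner_apply] at h
    simpa [dotProduct, mul_comm] using h

variable {ι : Type} [Fintype ι] {K : ι → Set (EuclideanSpace ℝ (Fin n))} {c : ι → ℝ}

lemma det_HM (x : EuclideanSpace ℝ (Fin n)) :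
    (∑ i, c i • Hm (K i) x).det = Matrix.det (∑ i, c i • HM (K i) x) := by
  rw [ContinuousLinearMap.det, ← LinearMap.det_toMatrix (EuclideanSpace.basisFun (Fin n) ℝ).toBasis]
  congr 1
  simp [HM, map_sum]

lemma gromov (hn : 1 ≤ n) (hK : ∀ i, IsConvexBody (K i)) (hc : ∀ i, 0 ≤ c i) :
    Integrable (fun x => Matrix.det (∑ i, c i • HM (K i) x)) ∧
    ∫ x, Matrix.det (∑ i, c i • HM (K i) x) = (volume (∑ i, c i • K i)).toReal := by
  have hne : Nonempty (Fin n) := ⟨⟨0, hn⟩⟩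
  by_cases hc' : ∃ i, 0 < c i
  · have h0 : ∀ x, 0 ≤ Matrix.det (∑ i, c i • HM (K i) x) := fun x =>
      (Matrix.posSemidef_sum _ fun i _ => (HM_posSemidef (hK i) x).smul (hc i)).det_nonneg
    have h1 := gromov_lintegral hK hc hc'
    have hm : Measurable fun x => Matrix.det (∑ i, c i • HM (K i) x) := by
      have : Measurable fun x => (∑ i, c i • Hm (K i) x).det :=
        ContinuousLinearMap.continuous_det.measurable.comp
          (Finset.measurable_fun_sum _ fun i _ => (Hm_meas hK i).const_smul (c i))
      simpa only [det_HM] using this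
    simp only [det_HM, abs_of_nonneg (h0 _)] at h1
    have hi : Integrable (fun x => Matrix.det (∑ i, c i • HM (K i) x)) := by
      refine ⟨hm.aestronglyMeasurable, ?_⟩
      rw [hasFiniteIntegral_iff_ofReal (Filter.Eventually.of_forall h0), h1]
      exact (sum_compact hK _).measure_lt_top
    refine ⟨hi, ?_⟩
    rw [integral_eq_lintegral_of_nonneg_ae (Filter.Eventually.of_forall h0) hm.aestronglyMeasurable, h1]
  · have hc0 : ∀ i, c i = 0 := fun i => le_antisymm (not_lt.1 fun h => hc' ⟨i, h⟩) (hc i)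
    have e : ∑ i, c i • K i = ({0} : Set (EuclideanSpace ℝ (Fin n))) := by
      refine (Finset.sum_eq_zero ?_).trans Set.singleton_zero.symm
      intro i _
      rw [hc0 i]
      refine Set.zero_smul_set ((hK i).2.2.mono interior_subset)
    rw [e]
    simp [hc0, Matrix.det_zero]

lemma mixed_eq (hn : 1 ≤ n) {K : Fin n → Set (EuclideanSpace ℝ (Fin n))}
    (hK : ∀ i, IsConvexBody (K i)) :
    Integrable (fun x => md fun a => HM (K a) x) ∧
      mixedVolume K = (n.factorial : ℝ)⁻¹ * ∫ x, md fun a => HM (K a) x := by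
  classical
  have hc : ∀ S : Finset (Fin n), ∀ i, (0 : ℝ) ≤ if i ∈ S then (1 : ℝ) else 0 := by
    intro S i; split_ifs <;> norm_num
  have hg := fun S : Finset (Fin n) => gromov hn hK (hc S)
  have hv : ∀ S : Finset (Fin n), ∑ i, (if i ∈ S then (1 : ℝ) else 0) • K i = ∑ i ∈ S, K i := by
    intro S
    rw [← Finset.sum_subset (Finset.subset_univ S)]
    · refine Finset.sum_congr rfl fun i hi => ?_
      simp [hi]
    · intro i _ hi
      rw [if_neg hi]
      exact Set.zero_smul_set ((hK i).2.2.mono interior_subset)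
  simp only [← polar]
  refine ⟨integrable_finsetSum _ fun S _ => (hg S).1.const_mul _, ?_⟩
  rw [integral_finsetSum _ fun S _ => (hg S).1.const_mul _, mixedVolume]
  simp only [integral_const_mul, (hg _).2, hv]

lemma vol_expand (hn : 1 ≤ n) (hK : ∀ i, IsConvexBody (K i)) (hc : ∀ i, 0 ≤ c i) :
    (volume (∑ i, c i • K i)).toReal =
      ∑ φ : Fin n → ι, (∏ j, c (φ j)) * mixedVolume (fun j => K (φ j)) := by
  rw [← (gromov hn hK hc).2]
  simp only [det_sum_md]
  rw [integral_finsetSum]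
  · refine Finset.sum_congr rfl fun φ _ => ?_
    rw [integral_const_mul, integral_const_mul, (mixed_eq hn fun j => hK (φ j)).2]
  · intro φ _
    exact ((mixed_eq hn fun j => hK (φ j)).1.const_mul _).const_mul _

lemma mixed_nonneg (hn : 1 ≤ n) {K : Fin n → Set (EuclideanSpace ℝ (Fin n))}
    (hK : ∀ i, IsConvexBody (K i)) : 0 ≤ mixedVolume K := by
  rw [(mixed_eq hn hK).2]
  exact mul_nonneg (by positivity) (integral_nonneg fun x => md_nonneg _ fun i => HM_posSemidef (hK i) x)

lemma mixed_symm (hn : 1 ≤ n) {K : Fin n → Set (EuclideanSpace ℝ (Fin n))}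
    (hK : ∀ i, IsConvexBody (K i)) (τ : Equiv.Perm (Fin n)) :
    mixedVolume (fun i => K (τ i)) = mixedVolume K := by
  rw [(mixed_eq hn hK).2, (mixed_eq hn fun i => hK (τ i)).2]
  congr 2
  funext x
  exact md_symm (fun a => HM (K a) x) τ

end IterFen

namespace IterFen

/-- The family consisting of `A` and the bodies `B k`. -/
def fam {n m : ℕ} (A : Set (EuclideanSpace ℝ (Fin n))) (B : Fin m → Set (EuclideanSpace ℝ (Fin n))) :
    Option (Fin m) → Set (EuclideanSpace ℝ (Fin n)) := fun o => o.elim A B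

/-- Number of indices not sent to `none`. -/
def cnt {n m : ℕ} (φ : Fin n → Option (Fin m)) : ℕ := (Finset.univ.filter fun i => φ i ≠ none).card

/-- Weights. -/
def wt {m : ℕ} (c : Fin m → ℝ) : Option (Fin m) → ℝ := fun o => o.elim 1 c

/-- Coefficients of the volume polynomial. -/
noncomputable def U {n m : ℕ} (A : Set (EuclideanSpace ℝ (Fin n)))
    (B : Fin m → Set (EuclideanSpace ℝ (Fin n))) (c : Fin m → ℝ) (j : ℕ) : ℝ :=
  ∑ φ : Fin n → Option (Fin m) with cnt φ = j,
    (∏ i, wt c (φ i)) * mixedVolume (fun i => fam A B (φ i))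

variable {n m : ℕ} {A : Set (EuclideanSpace ℝ (Fin n))}
  {B : Fin m → Set (EuclideanSpace ℝ (Fin n))} {c : Fin m → ℝ}

lemma fam_body (hA : IsConvexBody A) (hB : ∀ k, IsConvexBody (B k)) (o : Option (Fin m)) :
    IsConvexBody (fam A B o) := by
  cases o
  · exact hA
  · exact hB _

lemma wt_nonneg (hc : ∀ k, 0 ≤ c k) (o : Option (Fin m)) : 0 ≤ wt c o := by
  cases o
  · exact zero_le_one
  · exact hc _

lemma term_nonneg (hn : 1 ≤ n) (hA : IsConvexBody A) (hB : ∀ k, IsConvexBody (B k))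
    (hc : ∀ k, 0 ≤ c k) (φ : Fin n → Option (Fin m)) :
    0 ≤ (∏ i, wt c (φ i)) * mixedVolume (fun i => fam A B (φ i)) :=
  mul_nonneg (Finset.prod_nonneg fun _ _ => wt_nonneg hc _)
    (mixed_nonneg hn fun _ => fam_body hA hB _)

lemma U_nonneg (hn : 1 ≤ n) (hA : IsConvexBody A) (hB : ∀ k, IsConvexBody (B k))
    (hc : ∀ k, 0 ≤ c k) (j : ℕ) : 0 ≤ U A B c j :=
  Finset.sum_nonneg fun φ _ => term_nonneg hn hA hB hc φ

lemma cnt_le (φ : Fin n → Option (Fin m)) : cnt φ ≤ n := by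
  have := Finset.card_filter_le (Finset.univ : Finset (Fin n)) (fun i => φ i ≠ none)
  simpa [cnt] using this

lemma wt_prod (t : ℝ) (φ : Fin n → Option (Fin m)) :
    ∏ i, wt (fun k => t * c k) (φ i) = t ^ cnt φ * ∏ i, wt c (φ i) := by
  have : ∀ o : Option (Fin m), wt (fun k => t * c k) o = (if o ≠ none then t else 1) * wt c o := by
    intro o
    cases o <;> simp [wt]
  simp only [this]
  rw [Finset.prod_mul_distrib, Finset.prod_ite]
  simp [cnt]

lemma vol_poly (hn : 1 ≤ n) (hA : IsConvexBody A) (hB : ∀ k, IsConvexBody (B k))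
    (hc : ∀ k, 0 ≤ c k) {t : ℝ} (ht : 0 ≤ t) :
    (volume (A + t • ∑ k, c k • B k)).toReal = ∑ j ∈ Finset.range (n + 1), U A B c j * t ^ j := by
  have h := vol_expand (c := wt fun k => t * c k) hn (fam_body hA hB)
    (wt_nonneg fun k => mul_nonneg ht (hc k))
  have e : ∑ o, wt (fun k => t * c k) o • fam A B o = A + t • ∑ k, c k • B k := by
    rw [Fintype.sum_option, Finset.smul_sum]
    simp [wt, fam, smul_smul]
  rw [e] at h
  rw [h]
  simp only [wt_prod]
  rw [← Finset.sum_fiberwise_of_maps_to (s := Finset.univ) (t := Finset.range (n + 1)) (g := cnt)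
    (fun φ _ => Finset.mem_range.2 (Nat.lt_succ_of_le (cnt_le φ)))]
  refine Finset.sum_congr rfl fun j _ => ?_
  rw [U, Finset.sum_mul]
  refine Finset.sum_congr rfl fun φ hφ => ?_
  rw [(Finset.mem_filter.1 hφ).2]
  ring

lemma sum_nonempty (hB : ∀ k, IsConvexBody (B k)) : (∑ k, c k • B k).Nonempty := by
  choose x hx using fun k => (hB k).2.2
  exact ⟨∑ k, c k • x k, Set.finsetSum_mem_finsetSum _ _ _ fun k _ =>
    Set.smul_mem_smul_set (interior_subset (hx k))⟩

lemma U_zero (hn : 1 ≤ n) (hA : IsConvexBody A) (hB : ∀ k, IsConvexBody (B k))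
    (hc : ∀ k, 0 ≤ c k) : U A B c 0 = (volume A).toReal := by
  have h := vol_poly hn hA hB hc (le_refl (0 : ℝ))
  rw [Set.zero_smul_set (sum_nonempty hB), add_zero, Finset.sum_range_succ'] at h
  simpa using h.symm

lemma U_one (hn : 1 ≤ n) (hA : IsConvexBody A) (hB : ∀ k, IsConvexBody (B k)) :
    U A B c 1 = n * ∑ k, c k * mixedVolume (fun j : Fin n => if (j : ℕ) = 0 then B k else A) := by
  classical
  have h1 : ∀ (i : Fin n) (k : Fin m),
      mixedVolume (fun j => fam A B (if j = i then some k else none)) =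
        mixedVolume (fun j : Fin n => if (j : ℕ) = 0 then B k else A) := by
    intro i k
    rw [← mixed_symm hn (fun j => fam_body hA hB _) (Equiv.swap i ⟨0, hn⟩)]
    congr 1
    funext j
    have : (Equiv.swap i ⟨0, hn⟩ j = i) ↔ (j : ℕ) = 0 := by
      rw [Equiv.swap_apply_eq_iff, Equiv.swap_apply_left, Fin.ext_iff]
    simp only [this]
    split_ifs <;> rfl
  have h2 : ∀ (i : Fin n) (k : Fin m), ∏ j, wt c (if j = i then some k else none) = c k := by
    intro i k
    rw [Finset.prod_eq_single i]
    · simp [wt]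
    · intro j _ hj; simp [hj, wt]
    · simp
  have h3 : U A B c 1 = ∑ p : Fin n × Fin m,
      c p.2 * mixedVolume (fun j : Fin n => if (j : ℕ) = 0 then B p.2 else A) := by
    symm
    refine Finset.sum_bij (fun p _ => fun j => if j = p.1 then some p.2 else none) ?_ ?_ ?_ ?_
    · intro p _
      refine Finset.mem_filter.2 ⟨Finset.mem_univ _, ?_⟩
      rw [cnt, Finset.card_eq_one]
      refine ⟨p.1, ?_⟩
      ext j
      simp
    · rintro ⟨i, k⟩ _ ⟨i', k'⟩ _ h
      have h := congrFun h i
      simp only [if_true] at h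
      split_ifs at h with hi
      simp_all
    · intro φ hφ
      have hφ := (Finset.mem_filter.1 hφ).2
      rw [cnt, Finset.card_eq_one] at hφ
      obtain ⟨i, hi⟩ := hφ
      have hi' : ∀ j, φ j ≠ none ↔ j = i := by
        intro j
        have := Finset.ext_iff.1 hi j
        simpa using this
      obtain ⟨k, hk⟩ := Option.ne_none_iff_exists'.1 ((hi' i).2 rfl)
      refine ⟨(i, k), Finset.mem_univ _, ?_⟩
      funext j
      by_cases hj : j = i
      · subst hj; simp [hk]
      · have : φ j = none := by
          by_contra h; exact hj ((hi' j).1 h)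
        simp [hj, this]
    · rintro ⟨i, k⟩ _
      simp only
      rw [h1, h2]
  rw [h3, Fintype.sum_prod_type]
  simp

lemma U_top (hn : 1 ≤ n) (hmn : m ≤ n) (hA : IsConvexBody A) (hB : ∀ k, IsConvexBody (B k))
    (hc : ∀ k, 0 ≤ c k) :
    (n.descFactorial m : ℝ) * ((∏ k, c k) *
      mixedVolume (fun j : Fin n => if h : (j : ℕ) < m then B ⟨(j : ℕ), h⟩ else A)) ≤ U A B c m := by
  classical
  have hp : ∀ e : Fin m ↪ Fin n, ∀ k j, Function.partialInv e j = some k ↔ e k = j :=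
    fun e k j => e.injective.isPartialInv k j
  have h0 : (fun j : Fin n => if h : (j : ℕ) < m then B ⟨(j : ℕ), h⟩ else A) =
      fun j => fam A B (Function.partialInv (Fin.castLEEmb hmn) j) := by
    funext j
    split_ifs with h
    · rw [(hp (Fin.castLEEmb hmn) ⟨j, h⟩ j).2 (by simp)]
      rfl
    · have : Function.partialInv (Fin.castLEEmb hmn) j = none := by
        by_contra hne
        obtain ⟨k, hk⟩ := Option.ne_none_iff_exists'.1 hne
        have := (hp _ _ _).1 hk
        apply h
        rw [← this]
        exact k.2
      rw [this]; rfl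
  have h1 : ∀ e : Fin m ↪ Fin n, mixedVolume (fun j => fam A B (Function.partialInv e j)) =
      mixedVolume (fun j : Fin n => if h : (j : ℕ) < m then B ⟨(j : ℕ), h⟩ else A) := by
    intro e
    obtain ⟨g, hg⟩ := (Equiv.Perm.isMultiplyPretransitive (Fin n) m).exists_smul_eq
      (Fin.castLEEmb hmn) e
    have hg' : ∀ k, g (Fin.castLEEmb hmn k) = e k := fun k => by rw [← hg]; rfl
    rw [h0, ← mixed_symm hn (fun j => fam_body hA hB _) g]
    congr 1
    funext j
    congr 1
    apply Option.ext
    intro k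
    rw [hp, hp, ← hg', g.injective.eq_iff]
  have h2 : ∀ e : Fin m ↪ Fin n, ∏ j, wt c (Function.partialInv e j) = ∏ k, c k := by
    intro e
    rw [← Finset.prod_subset (Finset.subset_univ (Finset.univ.map e))]
    · rw [Finset.prod_map]
      refine Finset.prod_congr rfl fun k _ => ?_
      rw [(hp e k (e k)).2 rfl]; rfl
    · intro j _ hj
      have : Function.partialInv e j = none := by
        by_contra hne
        obtain ⟨k, hk⟩ := Option.ne_none_iff_exists'.1 hne
        exact hj (Finset.mem_map.2 ⟨k, Finset.mem_univ _, (hp _ _ _).1 hk⟩)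
      rw [this]; rfl
  have hinj : Function.Injective (fun e : Fin m ↪ Fin n => (Function.partialInv e : Fin n → Option (Fin m))) := by
    intro e e' h
    ext k
    have h3 := congrFun h (e k)
    simp only at h3
    rw [(hp e k (e k)).2 rfl] at h3
    rw [(hp e' k (e k)).1 h3.symm]
  calc _ = ∑ e : Fin m ↪ Fin n, (∏ i, wt c (Function.partialInv e i)) *
          mixedVolume (fun i => fam A B (Function.partialInv e i)) := by
        simp only [h1, h2]
        simp [Fintype.card_embedding_eq]
    _ = ∑ φ ∈ Finset.univ.map ⟨_, hinj⟩, (∏ i, wt c (φ i)) * mixedVolume (fun i => fam A B (φ i)) := by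
        rw [Finset.sum_map]; rfl
    _ ≤ U A B c m := by
        refine Finset.sum_le_sum_of_subset_of_nonneg ?_ fun φ _ _ => term_nonneg hn hA hB hc φ
        intro φ hφ
        obtain ⟨e, -, rfl⟩ := Finset.mem_map.1 hφ
        refine Finset.mem_filter.2 ⟨Finset.mem_univ _, ?_⟩
        have : (Finset.univ.filter fun i => Function.partialInv e i ≠ none) = Finset.univ.map e := by
          ext j
          simp only [Finset.mem_filter, Finset.mem_univ, true_and, Finset.mem_map,
            Option.ne_none_iff_exists', hp]
        simp only [Function.Embedding.coeFn_mk, cnt, this]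
        simp

end IterFen

namespace IterFen

variable {n : ℕ} {A : Set (EuclideanSpace ℝ (Fin n))}

lemma coeff_one_lower (u : ℕ → ℝ) (N : ℕ) (hN : 1 ≤ N) (δ : ℝ)
    (h : ∀ t : ℝ, 0 < t → u 0 + δ * t ≤ ∑ j ∈ Finset.range (N + 1), u j * t ^ j) : δ ≤ u 1 := by
  obtain ⟨N, rfl⟩ := Nat.exists_eq_succ_of_ne_zero (by omega : N ≠ 0)
  have h1 : ∀ t : ℝ, 0 < t → δ ≤ ∑ j ∈ Finset.range (N + 1), u (j + 1) * t ^ j := by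
    intro t ht
    have := h t ht
    rw [Nat.succ_eq_add_one, Finset.sum_range_succ'] at this
    simp only [pow_zero, mul_one, pow_succ, ← mul_assoc, ← Finset.sum_mul] at this
    have h2 : δ * t ≤ (∑ j ∈ Finset.range (N + 1), u (j + 1) * t ^ j) * t := by linarith
    exact le_of_mul_le_mul_right h2 ht
  have hc : Continuous fun t : ℝ => ∑ j ∈ Finset.range (N + 1), u (j + 1) * t ^ j := by fun_prop
  have hlim := (hc.tendsto 0).mono_left (nhdsWithin_le_nhds (s := Set.Ioi 0))
  have h3 := ge_of_tendsto hlim (Filter.mem_of_superset self_mem_nhdsWithin fun t ht => h1 t ht)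
  rw [Finset.sum_range_succ'] at h3
  simpa using h3

lemma vol_fin {m : ℕ} {B : Fin m → Set (EuclideanSpace ℝ (Fin n))} {c : Fin m → ℝ}
    (hA : IsConvexBody A) (hB : ∀ k, IsConvexBody (B k)) (t : ℝ) :
    volume (A + t • ∑ k, c k • B k) ≠ ⊤ :=
  (hA.2.1.add ((sum_compact hB Finset.univ).smul t)).measure_lt_top.ne

lemma first_pos (hn : 1 ≤ n) {B : Set (EuclideanSpace ℝ (Fin n))} (hA : IsConvexBody A)
    (hB : IsConvexBody B) :
    0 < mixedVolume (fun j : Fin n => if (j : ℕ) = 0 then B else A) := by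
  obtain ⟨q, hq⟩ := hB.2.2
  obtain ⟨r, hr, hball⟩ := Metric.isOpen_iff.1 isOpen_interior q hq
  obtain ⟨R, hR⟩ := hA.2.1.isBounded.exists_norm_le
  set ε := r / (2 * (|R| + 1)) with hε
  have hR0 : 0 < |R| + 1 := by positivity
  have hε0 : 0 < ε := by positivity
  have hsub : ∀ a ∈ A, q + ε • a ∈ B := by
    intro a ha
    refine interior_subset (hball ?_)
    rw [mem_ball_iff_norm, add_sub_cancel_left, norm_smul, Real.norm_of_nonneg hε0.le]
    have h1 : ‖a‖ ≤ |R| + 1 := (hR a ha).trans ((le_abs_self R).trans (by linarith))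
    calc ε * ‖a‖ ≤ ε * (|R| + 1) := by gcongr
      _ = r / 2 := by rw [hε]; field_simp
      _ < r := by linarith
  have hB' : ∀ k : Fin 1, IsConvexBody ((fun _ => B : Fin 1 → Set _) k) := fun _ => hB
  have hc : ∀ k : Fin 1, (0 : ℝ) ≤ (fun _ => 1 : Fin 1 → ℝ) k := fun _ => zero_le_one
  have hv := body_pos hA
  have hn' : (0 : ℝ) < n := by exact_mod_cast hn
  have key : n * ε * (volume A).toReal ≤ U A (fun _ : Fin 1 => B) (fun _ => 1) 1 := by
    refine coeff_one_lower _ n hn _ fun t ht => ?_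
    rw [← vol_poly hn hA hB' hc ht.le, U_zero hn hA hB' hc]
    have hs : (t • q) +ᵥ ((1 + t * ε) • A) ⊆ A + t • ∑ k : Fin 1, (1 : ℝ) • B := by
      rintro _ ⟨_, ⟨a, ha, rfl⟩, rfl⟩
      refine ⟨a, ha, t • (q + ε • a), ?_, ?_⟩
      · refine Set.smul_mem_smul_set ?_
        simpa using hsub a ha
      · simp only [vadd_eq_add]
        module
    have h1 := ENNReal.toReal_mono (vol_fin hA hB' t) (measure_mono (μ := volume) hs)
    rw [measure_vadd, vol_smul _ (by positivity)] at h1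
    refine le_trans ?_ h1
    have h2 := one_add_mul_le_pow (a := t * ε) (by nlinarith [mul_pos ht hε0]) n
    nlinarith
  rw [U_one hn hA hB'] at key
  have : 0 < n * ε * (volume A).toReal := by positivity
  have h3 := this.trans_le key
  simp only [one_mul, Finset.univ_unique, Finset.sum_singleton] at h3
  exact (mul_pos_iff_of_pos_left hn').1 h3

lemma main2 (m : ℕ) (hm : 2 ≤ m) (hmn : m ≤ n) (B : Fin m → Set (EuclideanSpace ℝ (Fin n)))
    (hA : IsConvexBody A) (hB : ∀ k, IsConvexBody (B k)) :
    (volume A).toReal ^ (m - 1) *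
        mixedVolume (fun j : Fin n => if h : (j : ℕ) < m then B ⟨(j : ℕ), h⟩ else A) ≤
      2 ^ (m * (m - 1) / 2) * ∏ k, mixedVolume (fun j : Fin n => if (j : ℕ) = 0 then B k else A) := by
  have hn : 1 ≤ n := by omega
  have hn' : (0 : ℝ) < n := by exact_mod_cast hn
  have hm' : (0 : ℝ) < m := by exact_mod_cast (by omega : 0 < m)
  set v0 := (volume A).toReal with hv0
  have hv : 0 < v0 := body_pos hA
  set b : Fin m → ℝ := fun k => mixedVolume (fun j : Fin n => if (j : ℕ) = 0 then B k else A) with hb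
  have hb0 : ∀ k, 0 < b k := fun k => first_pos hn hA (hB k)
  set LV := mixedVolume (fun j : Fin n => if h : (j : ℕ) < m then B ⟨(j : ℕ), h⟩ else A) with hLV
  set c : Fin m → ℝ := fun k => v0 / (m * b k) with hcdef
  have hc0 : ∀ k, 0 < c k := fun k => div_pos hv (mul_pos hm' (hb0 k))
  have hc : ∀ k, 0 ≤ c k := fun k => (hc0 k).le
  set v : ℕ → ℝ := fun j => U A B c j / (n.choose j * v0) with hvdef
  have hvn : ∀ j, 0 ≤ v j := fun j => div_nonneg (U_nonneg hn hA hB hc j) (by positivity)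
  have e0 : v 0 = 1 := by
    simp only [hvdef, U_zero hn hA hB hc]
    simp [← hv0, hv.ne']
  have e1 : v 1 = 1 := by
    simp only [hvdef, U_one hn hA hB]
    have : ∑ k, c k * mixedVolume (fun j : Fin n => if (j : ℕ) = 0 then B k else A) = v0 := by
      have : ∀ k, c k * b k = v0 / m := by
        intro k
        have := (hb0 k).ne'
        simp only [hcdef]
        field_simp
      simp only [hb] at this
      simp only [this]
      simp
      field_simp
    rw [this, Nat.choose_one_right]
    field_simp
  have hbs : ∀ t : ℝ, 0 ≤ t → bs n v t = v0⁻¹ * (volume (A + t • ∑ k, c k • B k)).toReal := by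
    intro t ht
    rw [vol_poly hn hA hB hc ht, bs, Finset.mul_sum]
    refine Finset.sum_congr rfl fun j hj => ?_
    have : (0 : ℝ) < n.choose j := by
      exact_mod_cast Nat.choose_pos (Nat.lt_succ_iff.1 (Finset.mem_range.1 hj))
    simp only [hvdef]
    field_simp
  have hconc : ConcaveOn ℝ (Set.Ici 0) (fun t => (bs n v t) ^ (1 / (n : ℝ))) := by
    have h1 := (vol_concave hn hA (sum_convex hB Finset.univ) (sum_compact hB Finset.univ)
      (sum_nonempty (c := c) hB)).smul (c := (v0⁻¹) ^ (1 / (n : ℝ))) (by positivity)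
    refine h1.congr fun t ht => ?_
    simp only [smul_eq_mul]
    rw [hbs t ht, Real.mul_rpow (by positivity) (by positivity)]
  have hfin := analytic n m hm hmn v hvn e0 e1 hconc
  have htop := U_top hn hmn hA hB hc
  rw [← hLV] at htop
  have hch : (0 : ℝ) < n.choose m := by exact_mod_cast Nat.choose_pos hmn
  have hfac : (0 : ℝ) < m.factorial := by exact_mod_cast m.factorial_pos
  have hP : 0 < ∏ k, b k := Finset.prod_pos fun k _ => hb0 k
  have hprod : ∏ k, c k = v0 ^ m / (m ^ m * ∏ k, b k) := by
    simp only [hcdef]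
    rw [Finset.prod_div_distrib, Finset.prod_mul_distrib]
    simp
  have hvm : (m.factorial : ℝ) * ((∏ k, c k) * LV) / v0 ≤ v m := by
    simp only [hvdef]
    rw [Nat.descFactorial_eq_factorial_mul_choose] at htop
    push_cast at htop
    rw [div_le_div_iff₀ hv (by positivity)]
    nlinarith
  have h1 : (m.factorial : ℝ) * ((∏ k, c k) * LV) / v0 * (m : ℝ) ^ m ≤
      2 ^ (m * (m - 1) / 2) * m.factorial := le_trans (by gcongr) hfin
  have hpow : v0 ^ m = v0 ^ (m - 1) * v0 := by
    rw [← pow_succ]; congr 1; omega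
  have h2 : (m.factorial : ℝ) * ((∏ k, c k) * LV) / v0 * (m : ℝ) ^ m =
      (v0 ^ (m - 1) * LV / ∏ k, b k) * m.factorial := by
    rw [hprod, hpow]
    field_simp
  rw [h2] at h1
  have h3 := le_of_mul_le_mul_right h1 hfac
  rwa [div_le_iff₀ hP] at h3

end IterFen


theorem iterated_fenchel (n m : ℕ) (hm : 1 ≤ m) (hmn : m ≤ n)
    (A : Set (EuclideanSpace ℝ (Fin n))) (B : Fin m → Set (EuclideanSpace ℝ (Fin n)))
    (hA : IsConvexBody A) (hB : ∀ k, IsConvexBody (B k)) :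
    (volume A).toReal ^ (m - 1) *
      mixedVolume (fun j : Fin n => if h : (j : ℕ) < m then B ⟨(j : ℕ), h⟩ else A) ≤
    2 ^ (m * (m - 1) / 2) *
      ∏ k, mixedVolume (fun j : Fin n => if (j : ℕ) = 0 then B k else A) := by
  rcases hm.eq_or_lt with rfl | hm2
  · have : (fun j : Fin n => if h : (j : ℕ) < 1 then B ⟨(j : ℕ), h⟩ else A) =
        fun j : Fin n => if (j : ℕ) = 0 then B 0 else A := by
      funext j
      by_cases h : (j : ℕ) = 0
      · simp [h]
      · simp [h]
    rw [this]
    simp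
  · exact IterFen.main2 m hm2 hmn B hA hB
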